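/- Let N ≥ 3, α > 0, k = k(α) = (2N-2+α)/(2+α), and let F : ℝ → ℝ be continuously differentiable. Suppose V_α ∈ C²((0,∞)) is a positive solution of -V'' - (k/t)V' = F(V) on (0,∞) with lim_{t→0⁺} V_α'(t) = 0 and lim_{t→∞} V_α(t) = 0, that V_α has Morse index one, and that V_α' ∈ E. Let u_α(x) = V_α((2/(2+α))|x|^{(2+α)/2}), and define the Morse index m(α) of u_α as the supremum of the dimensions of finite-dimensional linear subspaces W of D_α = {w ∈ C¹(ℝ^N∖{0}) : |x|^{α/2}w ∈ L²(ℝ^N), |∇w| ∈ L²(ℝ^N)} such that ∫_{ℝ^N}(|∇w|² − |x|^α F'(u_α)·w²) dx < 0 for every nonzero w ∈ W. Then m(α) = Σ_{i ∈ ℤ, 0 ≤ i < 1 + α/2} (N+2i-2)·(N+i-3)! / ((N-2)!·i!). -/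

import Mathlib

open MeasureTheory Filter Set Topology

/-- The Euclidean Laplacian: sum of second partial derivatives. -/
noncomputable def lap {N : ℕ} (u : EuclideanSpace ℝ (Fin N) → ℝ)
    (x : EuclideanSpace ℝ (Fin N)) : ℝ :=
  ∑ i : Fin N, fderiv ℝ (fun y => fderiv ℝ u y (EuclideanSpace.single i 1)) x
    (EuclideanSpace.single i 1)

/-- k(α) = (2N-2+α)/(2+α). -/
noncomputable def kk (N : ℕ) (α : ℝ) : ℝ := (2 * (N : ℝ) - 2 + α) / (2 + α)

/-- Membership in the space `E`: a `C¹` function on `(0,∞)` with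
`∫₀^∞ t^k ((w')² + w²) dt < ∞`. -/
def memE (k : ℝ) (w : ℝ → ℝ) : Prop :=
  ContDiffOn ℝ 1 w (Ioi 0) ∧
  IntegrableOn (fun t => t ^ k * ((deriv w t) ^ 2 + (w t) ^ 2)) (Ioi 0)

/-- The Rayleigh quotient
`R(w) = (∫₀^∞ t^k ((w')² − A·w²) dt) / (∫₀^∞ t^k w² dt)`. -/
noncomputable def Ray (k : ℝ) (A : ℝ → ℝ) (w : ℝ → ℝ) : ℝ :=
  (∫ t in Ioi (0:ℝ), t ^ k * ((deriv w t) ^ 2 - A t * (w t) ^ 2)) /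
    ∫ t in Ioi (0:ℝ), t ^ k * (w t) ^ 2

/-- Morse index one: the infimum of the Rayleigh quotient over nonzero elements of `E`
is negative, while on every two-dimensional subspace of `E` the maximum of the
Rayleigh quotient over nonzero elements is nonnegative. -/
def MorseIndexOne (k : ℝ) (A : ℝ → ℝ) : Prop :=
  (∃ w, memE k w ∧ (∃ t ∈ Ioi (0:ℝ), w t ≠ 0) ∧ Ray k A w < 0) ∧
  ∀ w₁ w₂ : ℝ → ℝ, memE k w₁ → memE k w₂ →
    (∀ c₁ c₂ : ℝ, (∀ t ∈ Ioi (0:ℝ), c₁ * w₁ t + c₂ * w₂ t = 0) → c₁ = 0 ∧ c₂ = 0) →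
    ∃ c₁ c₂ : ℝ, ¬(c₁ = 0 ∧ c₂ = 0) ∧
      0 ≤ Ray k A (fun t => c₁ * w₁ t + c₂ * w₂ t)

/-- Nondegeneracy: the linearized ODE `-w'' - (k/t) w' = A w` has no nontrivial
solution in `E`. -/
def RadNondeg (k : ℝ) (A : ℝ → ℝ) : Prop :=
  ∀ w : ℝ → ℝ, ContDiffOn ℝ 2 w (Ioi 0) → memE k w →
    (∀ t > (0:ℝ), -(deriv (deriv w) t) - k / t * deriv w t = A t * w t) →
    ∀ t > (0:ℝ), w t = 0

/-- A solution in `E` of the linearized ODE `-ψ'' - (k/t) ψ' = A ψ` on `(0,∞)`. -/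
def LinODESol (k : ℝ) (A : ℝ → ℝ) (ψ : ℝ → ℝ) : Prop :=
  ContDiffOn ℝ 2 ψ (Ioi 0) ∧ memE k ψ ∧
  ∀ t > (0:ℝ), -(deriv (deriv ψ) t) - k / t * deriv ψ t = A t * ψ t

/-- A solution of the linearized problem `-Δw = |x|^α a w` on `ℝ^N∖{0}` with
`|x|^{α/2} w ∈ L²(ℝ^N)` and `|∇w| ∈ L²(ℝ^N)`. -/
def LinSolution (N : ℕ) (α : ℝ) (a : EuclideanSpace ℝ (Fin N) → ℝ)
    (w : EuclideanSpace ℝ (Fin N) → ℝ) : Prop :=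
  ContDiffOn ℝ 2 w {x | x ≠ 0} ∧
  (∀ x : EuclideanSpace ℝ (Fin N), x ≠ 0 → -(lap w x) = ‖x‖ ^ α * a x * w x) ∧
  Integrable (fun x : EuclideanSpace ℝ (Fin N) => ‖x‖ ^ α * (w x) ^ 2) ∧
  Integrable (fun x : EuclideanSpace ℝ (Fin N) => ‖fderiv ℝ w x‖ ^ 2)

/-- `(N+2i)·(N+i-2)! / ((N-2)!·(i+1)!)`. -/
def dimN (N i : ℕ) : ℕ :=
  (N + 2 * i) * Nat.factorial (N + i - 2) / (Nat.factorial (N - 2) * Nat.factorial (i + 1))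

/-- Membership in `D_α`: `C¹` away from the origin, with `|x|^{α/2} w ∈ L²(ℝ^N)`
and `|∇w| ∈ L²(ℝ^N)`. -/
def Dmem (N : ℕ) (α : ℝ) (w : EuclideanSpace ℝ (Fin N) → ℝ) : Prop :=
  ContDiffOn ℝ 1 w {x | x ≠ 0} ∧
  Integrable (fun x : EuclideanSpace ℝ (Fin N) => ‖x‖ ^ α * (w x) ^ 2) ∧
  Integrable (fun x : EuclideanSpace ℝ (Fin N) => ‖fderiv ℝ w x‖ ^ 2)

/-- The quadratic form `Q(w) = ∫_{ℝ^N} (|∇w|² − |x|^α a w²) dx`. -/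
noncomputable def Qform (N : ℕ) (α : ℝ) (a w : EuclideanSpace ℝ (Fin N) → ℝ) : ℝ :=
  ∫ x : EuclideanSpace ℝ (Fin N),
    (‖fderiv ℝ w x‖ ^ 2 - ‖x‖ ^ α * a x * (w x) ^ 2)

/-- `Σ_{i ∈ ℤ, 0 ≤ i < 1+α/2} (N+2i-2)·(N+i-3)!/((N-2)!·i!)`. -/
noncomputable def mval (N : ℕ) (α : ℝ) : ℕ :=
  ∑ i ∈ Finset.range ⌈1 + α / 2⌉₊,
    (N + 2 * i - 2) * Nat.factorial (N + i - 3) / (Nat.factorial (N - 2) * Nat.factorial i)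

/-- A linear map that is symmetric for a positive definite symmetric bilinear form on a
finite-dimensional real space has a basis of eigenvectors orthonormal for that form. -/
theorem exists_orthonormal_eigenvectors {W : Type*} [AddCommGroup W] [Module ℝ W]
    [FiniteDimensional ℝ W] (B : W →ₗ[ℝ] W →ₗ[ℝ] ℝ) (hsymm : ∀ x y, B x y = B y x)
    (hpos : ∀ x, x ≠ 0 → 0 < B x x) (T : W →ₗ[ℝ] W) (hT : ∀ x y, B (T x) y = B x (T y)) :
    ∃ (e : Fin (Module.finrank ℝ W) → W) (μ : Fin (Module.finrank ℝ W) → ℝ),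
      (∀ i j, B (e i) (e j) = if i = j then 1 else 0) ∧ (∀ i, T (e i) = μ i • e i) ∧
      (∀ x, x = ∑ i, B (e i) x • e i) := by
  let core : InnerProductSpace.Core ℝ W :=
    { inner := fun x y => B x y
      conj_inner_symm := fun x y => by simpa using hsymm y x
      re_inner_nonneg := fun x => by
        by_cases h : x = 0
        · simp [h]
        · simpa using (hpos x h).le
      add_left := fun x y z => by simp
      smul_left := fun x y r => by simp
      definite := fun x hx => by
        by_contra h
        exact (hpos x h).ne' hx }
  let _ : NormedAddCommGroup W := core.toNormedAddCommGroup
  let _ : InnerProductSpace ℝ W := InnerProductSpace.ofCore core.toCore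
  have hin : ∀ x y : W, inner ℝ x y = B x y := fun x y => rfl
  have hsym : T.IsSymmetric := fun x y => hT x y
  let e := hsym.eigenvectorBasis rfl
  refine ⟨e, hsym.eigenvalues rfl, fun i j => ?_, fun i => ?_, fun x => ?_⟩
  · rw [← hin]
    exact orthonormal_iff_ite.1 e.orthonormal i j
  · exact hsym.apply_eigenvectorBasis rfl i
  · exact (e.sum_repr' x).symm

section Polynomials

variable {N : ℕ}

/-- Homogeneous polynomials of degree `M` in `N` variables. -/
abbrev HomPoly (N M : ℕ) : Submodule ℝ (MvPolynomial (Fin N) ℝ) :=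
  MvPolynomial.homogeneousSubmodule (Fin N) ℝ M

theorem finrank_homPoly (N M : ℕ) :
    Module.finrank ℝ (HomPoly N M) = (N + M - 1).choose M := by
  have h : HomPoly N M = MvPolynomial.restrictSupport ℝ {d : Fin N →₀ ℕ | d.degree = M} :=
    MvPolynomial.homogeneousSubmodule_eq_finsupp_supported _ _ _
  rw [h, Module.finrank_eq_nat_card_basis (MvPolynomial.basisRestrictSupport ℝ _)]
  have e : Sym (Fin N) M ≃ {d : Fin N →₀ ℕ | d.degree = M} := by
    refine (Sym.equivNatSum (Fin N) M).trans (Equiv.subtypeEquivRight fun d => ?_)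
    simp [Finsupp.degree_eq_sum, Finsupp.sum_fintype]
  rw [← Nat.card_congr e, Sym.natCard_sym_eq_choose]
  simp

instance (N M : ℕ) : FiniteDimensional ℝ (HomPoly N M) :=
  Module.Finite.iff_fg.2 (MvPolynomial.homogeneousSubmodule_fg _ _ _)

/-- The generator `x_a ∂_b - x_b ∂_a` of the rotations in the `(a,b)`-plane. -/
noncomputable def angPoly (a b : Fin N) :
    Derivation ℝ (MvPolynomial (Fin N) ℝ) (MvPolynomial (Fin N) ℝ) :=
  (MvPolynomial.X a : MvPolynomial (Fin N) ℝ) • MvPolynomial.pderiv b -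
    (MvPolynomial.X b : MvPolynomial (Fin N) ℝ) • MvPolynomial.pderiv a

theorem angPoly_apply (a b : Fin N) (p : MvPolynomial (Fin N) ℝ) :
    angPoly a b p = MvPolynomial.X a * MvPolynomial.pderiv b p -
      MvPolynomial.X b * MvPolynomial.pderiv a p := rfl

/-- The polynomial `|x|²`. -/
noncomputable def sqPoly (N : ℕ) : MvPolynomial (Fin N) ℝ := ∑ a, MvPolynomial.X a ^ 2

/-- The Laplacian on polynomials. -/
noncomputable def lapPoly : MvPolynomial (Fin N) ℝ →ₗ[ℝ] MvPolynomial (Fin N) ℝ :=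
  ∑ a, (MvPolynomial.pderiv a).toLinearMap ∘ₗ (MvPolynomial.pderiv a).toLinearMap

theorem lapPoly_apply (p : MvPolynomial (Fin N) ℝ) :
    lapPoly p = ∑ a, MvPolynomial.pderiv a (MvPolynomial.pderiv a p) := by
  simp [lapPoly]

/-- The negative spherical Laplacian on polynomials, as the Casimir operator of the rotations. -/
noncomputable def sphLap : MvPolynomial (Fin N) ℝ →ₗ[ℝ] MvPolynomial (Fin N) ℝ :=
  (-(1 / 2 : ℝ)) • ∑ a, ∑ b, (angPoly a b).toLinearMap ∘ₗ (angPoly a b).toLinearMap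

theorem sphLap_apply (p : MvPolynomial (Fin N) ℝ) :
    sphLap p = (-(1 / 2 : ℝ)) • ∑ a, ∑ b, angPoly a b (angPoly a b p) := by
  simp [sphLap]

/-- The eigenvalue `j(j+N-2)` of the spherical Laplacian. -/
def sphEig (N j : ℕ) : ℝ := j * (j + N - 2)

theorem sqPoly_isHomogeneous : (sqPoly N).IsHomogeneous 2 :=
  MvPolynomial.IsHomogeneous.sum _ _ _ fun a _ => MvPolynomial.isHomogeneous_X_pow a 2

theorem lapPoly_isHomogeneous {p : MvPolynomial (Fin N) ℝ} {M : ℕ} (hp : p.IsHomogeneous M) :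
    (lapPoly p).IsHomogeneous (M - 2) := by
  rw [lapPoly_apply]
  refine MvPolynomial.IsHomogeneous.sum _ _ _ fun a _ => ?_
  simpa [Nat.sub_sub] using hp.pderiv.pderiv

theorem angPoly_isHomogeneous {p : MvPolynomial (Fin N) ℝ} {M : ℕ} (hp : p.IsHomogeneous M)
    (a b : Fin N) : (angPoly a b p).IsHomogeneous M := by
  rw [angPoly_apply]
  rcases Nat.eq_zero_or_pos M with rfl | hM
  · have hc : p = MvPolynomial.C (MvPolynomial.coeff 0 p) := by
      rw [← MvPolynomial.totalDegree_eq_zero_iff_eq_C]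
      exact Nat.le_zero.1 hp.totalDegree_le
    rw [hc]
    simpa using MvPolynomial.isHomogeneous_zero (R := ℝ) (Fin N) 0
  · have h : ∀ c d : Fin N, (MvPolynomial.X c * MvPolynomial.pderiv d p).IsHomogeneous M := by
      intro c d
      have := (MvPolynomial.isHomogeneous_X ℝ c).mul (hp.pderiv (i := d))
      rwa [Nat.add_sub_cancel' hM] at this
    exact (h a b).sub (h b a)

theorem sphLap_isHomogeneous {p : MvPolynomial (Fin N) ℝ} {M : ℕ} (hp : p.IsHomogeneous M) :
    (sphLap p).IsHomogeneous M := by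
  rw [sphLap_apply]
  refine (HomPoly N M).smul_mem _ (Submodule.sum_mem _ fun a _ => Submodule.sum_mem _ fun b _ => ?_)
  exact angPoly_isHomogeneous (angPoly_isHomogeneous hp a b) a b

theorem angPoly_sqPoly (a b : Fin N) : angPoly a b (sqPoly N) = 0 := by
  have h : ∀ c : Fin N, MvPolynomial.pderiv c (sqPoly N) = 2 * MvPolynomial.X c := by
    intro c
    simp [sqPoly, MvPolynomial.pderiv_X, Pi.single_apply]
  rw [angPoly_apply, h, h]
  ring

theorem sphLap_sqPoly_mul (p : MvPolynomial (Fin N) ℝ) :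
    sphLap (sqPoly N * p) = sqPoly N * sphLap p := by
  simp [sphLap_apply, angPoly_sqPoly, Finset.mul_sum]

theorem sphLap_of_isHomogeneous {p : MvPolynomial (Fin N) ℝ} {M : ℕ} (hp : p.IsHomogeneous M) :
    sphLap p = sphEig N M • p - sqPoly N * lapPoly p := by
  have h1 : ∀ a b : Fin N, angPoly a b (angPoly a b p) =
      MvPolynomial.X a * MvPolynomial.pderiv b (MvPolynomial.X a * MvPolynomial.pderiv b p)
      - MvPolynomial.X a * MvPolynomial.pderiv b (MvPolynomial.X b * MvPolynomial.pderiv a p)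
      - MvPolynomial.X b * MvPolynomial.pderiv a (MvPolynomial.X a * MvPolynomial.pderiv b p)
      + MvPolynomial.X b * MvPolynomial.pderiv a (MvPolynomial.X b * MvPolynomial.pderiv a p) := by
    intro a b
    rw [angPoly_apply, angPoly_apply, map_sub, map_sub]
    ring
  have hE : ∑ a, MvPolynomial.X a * MvPolynomial.pderiv a p = (M : MvPolynomial (Fin N) ℝ) * p := by
    rw [hp.sum_X_mul_pderiv, nsmul_eq_mul]
  have hA : ∑ a : Fin N, ∑ b : Fin N,
      MvPolynomial.X a * MvPolynomial.pderiv b (MvPolynomial.X a * MvPolynomial.pderiv b p)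
      = (M : MvPolynomial (Fin N) ℝ) * p + sqPoly N * lapPoly p := by
    rw [← hE, lapPoly_apply, sqPoly, Finset.sum_mul_sum, ← Finset.sum_add_distrib]
    refine Finset.sum_congr rfl fun a _ => ?_
    simp only [Derivation.leibniz, MvPolynomial.pderiv_X, smul_eq_mul, mul_add,
      Finset.sum_add_distrib, Pi.single_apply]
    rw [add_comm]
    congr 1
    · simp
    · refine Finset.sum_congr rfl fun b _ => by ring
  have hB : ∑ a : Fin N, ∑ b : Fin N,
      MvPolynomial.X a * MvPolynomial.pderiv b (MvPolynomial.X b * MvPolynomial.pderiv a p)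
      = ((N : MvPolynomial (Fin N) ℝ) * M + M * M - M) * p := by
    have hEE : ∀ a, ∑ b, MvPolynomial.X b * MvPolynomial.pderiv b (MvPolynomial.pderiv a p) =
        ((M : MvPolynomial (Fin N) ℝ) - 1) * MvPolynomial.pderiv a p := by
      intro a
      rcases Nat.eq_zero_or_pos M with rfl | hM
      · have hc : p = MvPolynomial.C (MvPolynomial.coeff 0 p) := by
          rw [← MvPolynomial.totalDegree_eq_zero_iff_eq_C]
          exact Nat.le_zero.1 hp.totalDegree_le
        rw [hc]
        simp
      · rw [hp.pderiv.sum_X_mul_pderiv, nsmul_eq_mul, Nat.cast_sub hM, Nat.cast_one]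
    have : ∀ a : Fin N, ∑ b : Fin N,
      MvPolynomial.X a * MvPolynomial.pderiv b (MvPolynomial.X b * MvPolynomial.pderiv a p)
      = ((N : MvPolynomial (Fin N) ℝ) + (M : MvPolynomial (Fin N) ℝ) - 1) *
        (MvPolynomial.X a * MvPolynomial.pderiv a p) := by
      intro a
      rw [← Finset.mul_sum]
      have : ∑ b : Fin N, MvPolynomial.pderiv b (MvPolynomial.X b * MvPolynomial.pderiv a p)
          = ∑ b, MvPolynomial.X b * MvPolynomial.pderiv b (MvPolynomial.pderiv a p)
            + (N : MvPolynomial (Fin N) ℝ) * MvPolynomial.pderiv a p := by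
        simp [Derivation.leibniz, Finset.sum_add_distrib]
      rw [this, hEE]
      ring
    rw [Finset.sum_congr rfl fun a _ => this a, ← Finset.mul_sum, hE]
    ring
  have hA' := hA
  have hB' := hB
  rw [Finset.sum_comm] at hA' hB'
  rw [sphLap_apply]
  simp only [h1, Finset.sum_add_distrib, Finset.sum_sub_distrib]
  rw [hA, hA', hB, hB', sphEig, MvPolynomial.smul_eq_C_mul, MvPolynomial.smul_eq_C_mul]
  have h2 : (MvPolynomial.C (-(1 / 2 : ℝ)) : MvPolynomial (Fin N) ℝ) * 2 = -1 := by
    rw [← map_ofNat (MvPolynomial.C (σ := Fin N) (R := ℝ)) 2, ← MvPolynomial.C_mul]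
    norm_num
  have h3 : (MvPolynomial.C ((M : ℝ) * (M + N - 2)) : MvPolynomial (Fin N) ℝ)
      = M * (M + N - 2) := by
    rw [← map_ofNat (MvPolynomial.C (σ := Fin N) (R := ℝ)) 2]
    simp
  rw [h3]
  linear_combination ((M : MvPolynomial (Fin N) ℝ) * p + sqPoly N * lapPoly p
    - (N * M + M * M - M) * p) * h2

theorem sqPoly_ne_zero [NeZero N] : sqPoly N ≠ 0 := by
  intro h
  have := congrArg (MvPolynomial.eval fun _ => (1 : ℝ)) h
  simp [sqPoly] at this
  exact NeZero.ne N this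

theorem sphLap_eigenvector [NeZero N] {μ : ℝ} : ∀ {M : ℕ} {p : MvPolynomial (Fin N) ℝ},
    p.IsHomogeneous M → p ≠ 0 → sphLap p = μ • p →
    ∃ (j a : ℕ) (q : MvPolynomial (Fin N) ℝ), 2 * a + j = M ∧ μ = sphEig N j ∧
      q.IsHomogeneous j ∧ p = sqPoly N ^ a * q := by
  intro M
  induction M using Nat.strong_induction_on with
  | _ M ih =>
    intro p hp hp0 hTp
    by_cases hμ : μ = sphEig N M
    · exact ⟨M, 0, p, by simp, hμ, hp, by simp⟩
    have h1 : (sphEig N M - μ) • p = sqPoly N * lapPoly p := by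
      rw [sub_smul, ← hTp, sphLap_of_isHomogeneous hp]
      abel
    have hne : sphEig N M - μ ≠ 0 := sub_ne_zero.2 (Ne.symm hμ)
    have h2 : p = sqPoly N * ((sphEig N M - μ)⁻¹ • lapPoly p) := by
      rw [mul_smul_comm, ← h1, smul_smul, inv_mul_cancel₀ hne, one_smul]
    have hq := (HomPoly N (M - 2)).smul_mem (sphEig N M - μ)⁻¹ (lapPoly_isHomogeneous hp)
    set q := (sphEig N M - μ)⁻¹ • lapPoly p with hqdef
    have hq0 : q ≠ 0 := by
      intro h
      rw [h, mul_zero] at h2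
      exact hp0 h2
    have hM : 2 ≤ M := by
      have : (sqPoly N * q).IsHomogeneous (2 + (M - 2)) := sqPoly_isHomogeneous.mul hq
      rw [← h2] at this
      have := hp.inj_right this hp0
      omega
    have hTq : sphLap q = μ • q := by
      have h3 : sqPoly N * sphLap q = sqPoly N * (μ • q) := by
        rw [← sphLap_sqPoly_mul, ← h2, hTp, mul_smul_comm, ← h2]
      exact mul_left_cancel₀ sqPoly_ne_zero h3
    obtain ⟨j, a, r, hja, hμj, hr, hqr⟩ := ih (M - 2) (by omega) hq hq0 hTq
    exact ⟨j, a + 1, r, by omega, hμj, hr, by rw [h2, hqr]; ring⟩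

end Polynomials

theorem harmonic_dim (n j : ℕ) :
    (n + 2 * j + 5) * Nat.factorial (n + j + 2) / (Nat.factorial (n + 1) * Nat.factorial (j + 2)) +
      (n + j + 2).choose j = (n + j + 4).choose (j + 2) := by
  have h1 := Nat.add_choose_mul_factorial_mul_factorial (n + 2) (j + 2)
  have h2 := Nat.add_choose_mul_factorial_mul_factorial (n + 2) j
  rw [show n + 2 + (j + 2) = n + j + 4 by ring] at h1
  rw [show n + 2 + j = n + j + 2 by ring] at h2
  have hle : (n + j + 2).choose j ≤ (n + j + 4).choose (j + 2) := by
    rw [Nat.choose_succ_succ (n + j + 3) (j + 1), Nat.choose_succ_succ (n + j + 2) j]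
    omega
  obtain ⟨D, hD⟩ := Nat.exists_eq_add_of_le' hle
  rw [hD]
  congr 1
  refine Nat.div_eq_of_eq_mul_left (by positivity) ?_
  rw [hD] at h1
  have e1 : (n + j + 4).factorial = (n + j + 4) * ((n + j + 3) * (n + j + 2).factorial) := by
    rw [Nat.factorial_succ, Nat.factorial_succ]
  have e2 : (j + 2).factorial = (j + 2) * ((j + 1) * j.factorial) := by
    rw [Nat.factorial_succ, Nat.factorial_succ]
  have e3 : (n + 2).factorial = (n + 2) * (n + 1).factorial := Nat.factorial_succ _
  have : (n + 2) * ((n + 2 * j + 5) * Nat.factorial (n + j + 2)) =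
      (n + 2) * (D * (Nat.factorial (n + 1) * Nat.factorial (j + 2))) := by
    zify at h1 h2 e1 e2 e3 ⊢
    rw [e3] at h1 h2
    rw [e1, ← h2] at h1
    rw [← h2]
    rw [e2] at h1 ⊢
    linear_combination -h1
  exact Nat.eq_of_mul_eq_mul_left (by omega) this

theorem sum_harmonic_dim (n m : ℕ) :
    ∑ i ∈ Finset.range (m + 2), (n + 3 + 2 * i - 2) * Nat.factorial (n + 3 + i - 3) /
      (Nat.factorial (n + 3 - 2) * Nat.factorial i) =
      (n + m + 3).choose (m + 1) + (n + m + 2).choose m := by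
  induction m with
  | zero =>
    have e : (n + 3 + 2 * 1 - 2) * Nat.factorial (n + 3 + 1 - 3) /
      (Nat.factorial (n + 3 - 2) * Nat.factorial 1) = n + 3 := by
      rw [show n + 3 + 2 * 1 - 2 = n + 3 by omega, show n + 3 + 1 - 3 = n + 1 by omega,
        show n + 3 - 2 = n + 1 by omega, Nat.factorial_one, mul_one]
      exact Nat.mul_div_cancel _ (Nat.factorial_pos _)
    have e0 : (n + 3 + 2 * 0 - 2) * Nat.factorial (n + 3 + 0 - 3) /
      (Nat.factorial (n + 3 - 2) * Nat.factorial 0) = 1 := by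
      rw [show n + 3 + 2 * 0 - 2 = n + 1 by omega, show n + 3 + 0 - 3 = n by omega,
        ← Nat.factorial_succ, Nat.factorial_zero, mul_one]
      exact Nat.div_self (Nat.factorial_pos _)
    rw [Finset.sum_range_succ, Finset.sum_range_succ, Finset.sum_range_zero, e, e0]
    simp
    ring
  | succ m ih =>
    rw [Finset.sum_range_succ, ih]
    have h := harmonic_dim n m
    rw [show n + 3 + 2 * (m + 2) - 2 = n + 2 * m + 5 by omega,
      show n + 3 + (m + 2) - 3 = n + m + 2 by omega, show n + 3 - 2 = n + 1 by omega]
    rw [show n + (m + 1) + 3 = n + m + 4 by ring, show m + 1 + 1 = m + 2 by ring,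
      show n + (m + 1) + 2 = n + m + 3 by ring]
    omega

theorem mval_eq_finrank (N : ℕ) (hN : 3 ≤ N) (α : ℝ) (m : ℕ) (hm : ⌈1 + α / 2⌉₊ = m + 2) :
    mval N α = Module.finrank ℝ (HomPoly N (m + 1) × HomPoly N m) := by
  obtain ⟨n, rfl⟩ := Nat.exists_eq_add_of_le' hN
  rw [mval, hm, sum_harmonic_dim, Module.finrank_prod, finrank_homPoly, finrank_homPoly]
  rw [show n + 3 + (m + 1) - 1 = n + m + 3 by omega, show n + 3 + m - 1 = n + m + 2 by omega]

section Sphere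

variable {N : ℕ}

/-- The unit sphere of `ℝ^N`. -/
abbrev Sph (N : ℕ) : Type := Metric.sphere (0 : EuclideanSpace ℝ (Fin N)) 1

/-- The surface measure of the unit sphere. -/
noncomputable abbrev sphMeas (N : ℕ) : Measure (Sph N) :=
  (volume : Measure (EuclideanSpace ℝ (Fin N))).toSphere

theorem Sph.norm_eq (θ : Sph N) : ‖(θ : EuclideanSpace ℝ (Fin N))‖ = 1 :=
  norm_eq_of_mem_sphere θ

theorem Sph.ne_zero (θ : Sph N) : (θ : EuclideanSpace ℝ (Fin N)) ≠ 0 :=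
  ne_zero_of_mem_unit_sphere θ

theorem integrable_sphMeas {f : Sph N → ℝ} (hf : Continuous f) : Integrable f (sphMeas N) :=
  hf.integrable_of_hasCompactSupport (HasCompactSupport.of_compactSpace f)

open scoped Pointwise in
theorem integral_sphMeas_isometry (R : EuclideanSpace ℝ (Fin N) ≃ₗᵢ[ℝ] EuclideanSpace ℝ (Fin N))
    (g : EuclideanSpace ℝ (Fin N) → ℝ) :
    ∫ θ : Sph N, g (R θ) ∂sphMeas N = ∫ θ : Sph N, g θ ∂sphMeas N := by
  let Rs : Sph N ≃ₜ Sph N :=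
    { toFun := fun θ => ⟨R θ, by simp⟩
      invFun := fun θ => ⟨R.symm θ, by simp⟩
      left_inv := fun θ => by simp
      right_inv := fun θ => by simp
      continuous_toFun := by fun_prop
      continuous_invFun := by fun_prop }
  have hmap : Measure.map Rs (sphMeas N) = sphMeas N := by
    ext s hs
    rw [Measure.map_apply Rs.continuous.measurable hs, Measure.toSphere_apply' _ hs,
      Measure.toSphere_apply' _ (Rs.continuous.measurable hs)]
    congr 1
    rw [← R.measurePreserving.measure_preimage_emb R.toHomeomorph.measurableEmbedding
      (Ioo (0 : ℝ) 1 • ((↑) '' s : Set (EuclideanSpace ℝ (Fin N))))]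
    congr 1
    ext x
    simp only [mem_preimage, Set.mem_smul, mem_image]
    constructor
    · rintro ⟨r, hr, _, ⟨θ, hθ, rfl⟩, rfl⟩
      exact ⟨r, hr, R θ, ⟨Rs θ, hθ, rfl⟩, by simp⟩
    · rintro ⟨r, hr, _, ⟨θ, hθ, rfl⟩, h⟩
      refine ⟨r, hr, R.symm θ, ⟨Rs.symm θ, by simpa using hθ, rfl⟩, ?_⟩
      apply R.injective
      rw [map_smul, R.apply_symm_apply]
      exact h
  have h := Rs.measurableEmbedding.integral_map (μ := sphMeas N) (fun θ : Sph N => g θ)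
  rw [hmap] at h
  exact h.symm

/-- The rotation field `x ↦ x_a e_b - x_b e_a`. -/
noncomputable def rotField (a b : Fin N) :
    EuclideanSpace ℝ (Fin N) →L[ℝ] EuclideanSpace ℝ (Fin N) :=
  (EuclideanSpace.proj a).smulRight (EuclideanSpace.single b (1 : ℝ)) -
    (EuclideanSpace.proj b).smulRight (EuclideanSpace.single a (1 : ℝ))

theorem rotField_apply (a b : Fin N) (x : EuclideanSpace ℝ (Fin N)) :
    rotField a b x = x a • EuclideanSpace.single b (1 : ℝ) -
      x b • EuclideanSpace.single a (1 : ℝ) := by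
  simp [rotField]

theorem rotField_mem_skewAdjoint (a b : Fin N) :
    rotField a b ∈ skewAdjoint (EuclideanSpace ℝ (Fin N) →L[ℝ] EuclideanSpace ℝ (Fin N)) := by
  rw [skewAdjoint.mem_iff, ContinuousLinearMap.star_eq_adjoint, eq_comm,
    ContinuousLinearMap.eq_adjoint_iff]
  intro x y
  simp only [neg_apply, rotField_apply, inner_neg_left, inner_sub_left,
    inner_sub_right, inner_smul_left, inner_smul_right, EuclideanSpace.inner_single_left,
    EuclideanSpace.inner_single_right]
  simp
  ring

theorem exists_rotation (a b : Fin N) :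
    ∃ R : ℝ → EuclideanSpace ℝ (Fin N) ≃ₗᵢ[ℝ] EuclideanSpace ℝ (Fin N),
      (∀ x, R 0 x = x) ∧ ∀ t x, HasDerivAt (fun s => R s x) (rotField a b (R t x)) t := by
  have hmem : ∀ t : ℝ, NormedSpace.exp (t • rotField a b) ∈
      unitary (EuclideanSpace ℝ (Fin N) →L[ℝ] EuclideanSpace ℝ (Fin N)) := fun t => by
    let _ : NormedAlgebra ℚ (EuclideanSpace ℝ (Fin N) →L[ℝ] EuclideanSpace ℝ (Fin N)) :=
      NormedAlgebra.restrictScalars ℚ ℝ _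
    exact NormedSpace.exp_mem_unitary_of_mem_skewAdjoint
      (skewAdjoint.smul_mem t (rotField_mem_skewAdjoint a b))
  refine ⟨fun t => Unitary.linearIsometryEquiv ⟨_, hmem t⟩, fun x => ?_, fun t x => ?_⟩
  · have e : NormedSpace.exp ((0 : ℝ) • rotField a b) = 1 :=
      (congrArg NormedSpace.exp (zero_smul ℝ (rotField a b))).trans NormedSpace.exp_zero
    exact congrArg (fun T => T x) e
  · have h := hasDerivAt_exp_smul_const' (𝕂 := ℝ) (rotField a b) t
    have h2 := HasDerivAt.clm_apply h (hasDerivAt_const t x)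
    simp only [mul_apply_eq_comp, map_zero, add_zero] at h2
    exact h2

/-- The derivative of `f` along the rotation field of the `(a,b)`-plane. -/
noncomputable def angDeriv (a b : Fin N) (f : EuclideanSpace ℝ (Fin N) → ℝ)
    (x : EuclideanSpace ℝ (Fin N)) : ℝ :=
  fderiv ℝ f x (rotField a b x)

theorem continuousOn_angDeriv {f : EuclideanSpace ℝ (Fin N) → ℝ}
    (hf : ContDiffOn ℝ 1 f {x | x ≠ 0}) (a b : Fin N) :
    ContinuousOn (angDeriv a b f) {x | x ≠ 0} :=
  (hf.continuousOn_fderiv_of_isOpen isOpen_ne le_rfl).clm_apply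
    (rotField a b).continuous.continuousOn

theorem continuous_sph {f : EuclideanSpace ℝ (Fin N) → ℝ} (hf : ContinuousOn f {x | x ≠ 0}) :
    Continuous fun θ : Sph N => f θ :=
  hf.comp_continuous continuous_subtype_val fun θ => θ.ne_zero

theorem ContDiffOn.differentiableAt_ne_zero {f : EuclideanSpace ℝ (Fin N) → ℝ}
    (hf : ContDiffOn ℝ 1 f {x | x ≠ 0}) {x : EuclideanSpace ℝ (Fin N)} (hx : x ≠ 0) :
    DifferentiableAt ℝ f x :=
  (hf.differentiableOn one_ne_zero).differentiableAt (isOpen_ne.mem_nhds hx)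

theorem integral_angDeriv {f : EuclideanSpace ℝ (Fin N) → ℝ}
    (hf : ContDiffOn ℝ 1 f {x | x ≠ 0}) (a b : Fin N) :
    ∫ θ : Sph N, angDeriv a b f θ ∂sphMeas N = 0 := by
  obtain ⟨R, hR0, hR⟩ := exists_rotation a b
  have hcont := continuous_sph (continuousOn_angDeriv hf a b)
  obtain ⟨C, hC⟩ := (isCompact_range hcont).isBounded.exists_norm_le
  have hC' : ∀ x : EuclideanSpace ℝ (Fin N), ‖x‖ = 1 → ‖angDeriv a b f x‖ ≤ C := fun x hx =>
    hC _ ⟨⟨x, by simpa using hx⟩, rfl⟩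
  have hne : ∀ (t : ℝ) (θ : Sph N), R t θ ≠ 0 := fun t θ => by simpa using θ.ne_zero
  have key := hasDerivAt_integral_of_dominated_loc_of_deriv_le (μ := sphMeas N) (x₀ := (0 : ℝ))
    (F := fun t (θ : Sph N) => f (R t θ)) (F' := fun t θ => angDeriv a b f (R t θ))
    (bound := fun _ => C) (s := univ) univ_mem
    (Eventually.of_forall fun t => ((hf.continuousOn.comp_continuous
      ((R t).continuous.comp continuous_subtype_val) (hne t)).aestronglyMeasurable))
    (integrable_sphMeas (hf.continuousOn.comp_continuous
      ((R 0).continuous.comp continuous_subtype_val) (hne 0)))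
    (((continuousOn_angDeriv hf a b).comp_continuous
      ((R 0).continuous.comp continuous_subtype_val) (hne 0)).aestronglyMeasurable)
    (Eventually.of_forall fun θ t _ => hC' _ (by simp [θ.norm_eq]))
    (integrable_const C)
    (Eventually.of_forall fun θ t _ =>
      ((hf.differentiableAt_ne_zero (hne t θ)).hasFDerivAt.comp_hasDerivAt t (hR t θ)))
  have h2 := key.2
  simp only [integral_sphMeas_isometry (R _) f, hR0] at h2
  exact h2.unique (hasDerivAt_const _ _)

theorem angDeriv_mul {f g : EuclideanSpace ℝ (Fin N) → ℝ} {x : EuclideanSpace ℝ (Fin N)}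
    (hf : DifferentiableAt ℝ f x) (hg : DifferentiableAt ℝ g x) (a b : Fin N) :
    angDeriv a b (fun y => f y * g y) x = f x * angDeriv a b g x + angDeriv a b f x * g x := by
  simp only [angDeriv]
  rw [fderiv_fun_mul hf hg]
  simp [mul_comm]

theorem integral_angDeriv_mul {f g : EuclideanSpace ℝ (Fin N) → ℝ}
    (hf : ContDiffOn ℝ 1 f {x | x ≠ 0}) (hg : ContDiffOn ℝ 1 g {x | x ≠ 0}) (a b : Fin N) :
    ∫ θ : Sph N, angDeriv a b f θ * g θ ∂sphMeas N =
      -∫ θ : Sph N, f θ * angDeriv a b g θ ∂sphMeas N := by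
  have h := integral_angDeriv (hf.mul hg) a b
  have h1 : ∀ θ : Sph N, angDeriv a b (fun y => f y * g y) θ =
      f θ * angDeriv a b g θ + angDeriv a b f θ * g θ := fun θ =>
    angDeriv_mul (hf.differentiableAt_ne_zero θ.ne_zero) (hg.differentiableAt_ne_zero θ.ne_zero) a b
  change ∫ θ : Sph N, angDeriv a b (fun y => f y * g y) θ ∂sphMeas N = 0 at h
  simp only [h1] at h
  rw [integral_add] at h
  · linarith
  · exact integrable_sphMeas ((continuous_sph hf.continuousOn).mul
      (continuous_sph (continuousOn_angDeriv hg a b)))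
  · exact integrable_sphMeas ((continuous_sph (continuousOn_angDeriv hf a b)).mul
      (continuous_sph hg.continuousOn))

/-- The function on `ℝ^N` defined by a polynomial. -/
noncomputable def polyFun (p : MvPolynomial (Fin N) ℝ) (x : EuclideanSpace ℝ (Fin N)) : ℝ :=
  MvPolynomial.eval (fun i => x i) p

theorem hasFDerivAt_polyFun (p : MvPolynomial (Fin N) ℝ) (x : EuclideanSpace ℝ (Fin N)) :
    HasFDerivAt (polyFun p)
      (∑ i, polyFun (MvPolynomial.pderiv i p) x • (EuclideanSpace.proj i :
        EuclideanSpace ℝ (Fin N) →L[ℝ] ℝ)) x := by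
  induction p using MvPolynomial.induction_on with
  | C c =>
    have e : polyFun (MvPolynomial.C c) = fun _ : EuclideanSpace ℝ (Fin N) => c := by
      funext y; simp [polyFun]
    rw [e]
    refine (hasFDerivAt_const c x).congr_fderiv ?_
    simp [polyFun]
  | add p q hp hq =>
    have e : polyFun (p + q) = polyFun p + polyFun q := by
      funext y; simp [polyFun]
    rw [e]
    refine (hp.add hq).congr_fderiv ?_
    simp [polyFun, add_smul, Finset.sum_add_distrib]
  | mul_X p j hp =>
    have h := hp.mul
      ((EuclideanSpace.proj j : EuclideanSpace ℝ (Fin N) →L[ℝ] ℝ).hasFDerivAt (x := x))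
    have e : polyFun (p * MvPolynomial.X j) =
        fun y : EuclideanSpace ℝ (Fin N) => polyFun p y * y j := by
      funext y; simp [polyFun]
    rw [e]
    refine h.congr_fderiv ?_
    ext v
    simp [polyFun, MvPolynomial.pderiv_X, Pi.single_apply, Finset.sum_add_distrib, add_mul,
      Finset.mul_sum, apply_ite, mul_assoc]

theorem contDiff_polyFun (p : MvPolynomial (Fin N) ℝ) : ContDiff ℝ 1 (polyFun p) := by
  induction p using MvPolynomial.induction_on with
  | C c =>
    have e : polyFun (MvPolynomial.C c) = fun _ : EuclideanSpace ℝ (Fin N) => c := by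
      funext y; simp [polyFun]
    exact e ▸ contDiff_const
  | add p q hp hq =>
    have e : polyFun (p + q) = fun y => polyFun p y + polyFun q y := by
      funext y; simp [polyFun]
    exact e ▸ hp.add hq
  | mul_X p j hp =>
    have e : polyFun (p * MvPolynomial.X j) = fun y => polyFun p y * y j := by
      funext y; simp [polyFun]
    exact e ▸ hp.mul (EuclideanSpace.proj j : EuclideanSpace ℝ (Fin N) →L[ℝ] ℝ).contDiff

theorem contDiffOn_polyFun (p : MvPolynomial (Fin N) ℝ) :
    ContDiffOn ℝ 1 (polyFun p) {x | x ≠ 0} := (contDiff_polyFun p).contDiffOn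

theorem continuous_polyFun_sph (p : MvPolynomial (Fin N) ℝ) :
    Continuous fun θ : Sph N => polyFun p θ := continuous_sph (contDiffOn_polyFun p).continuousOn

theorem angDeriv_polyFun (a b : Fin N) (p : MvPolynomial (Fin N) ℝ) :
    angDeriv a b (polyFun p) = polyFun (angPoly a b p) := by
  funext x
  rw [angDeriv, (hasFDerivAt_polyFun p x).fderiv, rotField_apply, angPoly_apply]
  simp [polyFun, mul_sub, Finset.sum_sub_distrib]
  ring

/-- The Dirichlet form of the unit sphere. -/
noncomputable def sphDir (f g : EuclideanSpace ℝ (Fin N) → ℝ) : ℝ :=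
  1 / 2 * ∑ a, ∑ b, ∫ θ : Sph N, angDeriv a b f θ * angDeriv a b g θ ∂sphMeas N

theorem sphDir_polyFun {f : EuclideanSpace ℝ (Fin N) → ℝ} (hf : ContDiffOn ℝ 1 f {x | x ≠ 0})
    (p : MvPolynomial (Fin N) ℝ) :
    sphDir f (polyFun p) = ∫ θ : Sph N, f θ * polyFun (sphLap p) θ ∂sphMeas N := by
  have h1 : ∀ x : EuclideanSpace ℝ (Fin N), f x * polyFun (sphLap p) x =
      -(1 / 2) * ∑ a, ∑ b, f x * polyFun (angPoly a b (angPoly a b p)) x := by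
    intro x
    simp only [sphLap_apply, polyFun, MvPolynomial.smul_eval, map_sum, ← Finset.mul_sum]
    ring
  simp only [h1]
  rw [integral_const_mul, integral_finsetSum, sphDir, neg_mul, ← mul_neg, ← Finset.sum_neg_distrib]
  · congr 1
    refine Finset.sum_congr rfl fun a _ => ?_
    rw [integral_finsetSum, ← Finset.sum_neg_distrib]
    · refine Finset.sum_congr rfl fun b _ => ?_
      rw [angDeriv_polyFun, integral_angDeriv_mul hf (contDiffOn_polyFun _), angDeriv_polyFun]
    · exact fun b _ => integrable_sphMeas
        ((continuous_sph hf.continuousOn).mul (continuous_polyFun_sph _))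
  · refine fun a _ => integrable_finsetSum _ fun b _ => integrable_sphMeas
        ((continuous_sph hf.continuousOn).mul (continuous_polyFun_sph _))

end Sphere

section SphericalPolynomials

variable {N : ℕ}

theorem polyFun_smul {p : MvPolynomial (Fin N) ℝ} {M : ℕ} (hp : p.IsHomogeneous M) (c : ℝ)
    (x : EuclideanSpace ℝ (Fin N)) : polyFun p (c • x) = c ^ M * polyFun p x := by
  simp only [polyFun, MvPolynomial.eval_eq', Finset.mul_sum]
  refine Finset.sum_congr rfl fun d hd => ?_
  have hd' : ∑ i, d i = M := by
    rw [← hp (MvPolynomial.mem_support_iff.1 hd), Finsupp.weight_apply, Finsupp.sum_fintype]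
    · simp
    · simp
  simp only [PiLp.smul_apply, smul_eq_mul, mul_pow, Finset.prod_mul_distrib,
    Finset.prod_pow_eq_pow_sum, hd']
  ring

theorem polyFun_add (p q : MvPolynomial (Fin N) ℝ) (x : EuclideanSpace ℝ (Fin N)) :
    polyFun (p + q) x = polyFun p x + polyFun q x := by simp [polyFun]

theorem polyFun_smul_poly (c : ℝ) (p : MvPolynomial (Fin N) ℝ) (x : EuclideanSpace ℝ (Fin N)) :
    polyFun (c • p) x = c * polyFun p x := by simp [polyFun]

theorem polyFun_sum {ι : Type*} (s : Finset ι) (p : ι → MvPolynomial (Fin N) ℝ)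
    (x : EuclideanSpace ℝ (Fin N)) :
    polyFun (∑ i ∈ s, p i) x = ∑ i ∈ s, polyFun (p i) x := by simp [polyFun]

theorem polyFun_sqPoly (θ : Sph N) : polyFun (sqPoly N) θ = 1 := by
  have h := EuclideanSpace.norm_sq_eq (θ : EuclideanSpace ℝ (Fin N))
  rw [θ.norm_eq] at h
  simpa [polyFun, sqPoly] using h.symm

theorem polyFun_sqPoly_pow_mul (a : ℕ) (p : MvPolynomial (Fin N) ℝ) (θ : Sph N) :
    polyFun (sqPoly N ^ a * p) θ = polyFun p θ := by
  have h := polyFun_sqPoly θ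
  simp only [polyFun] at h
  simp [polyFun, h]

theorem eq_zero_of_polyFun_sph_eq_zero [NeZero N] {p : MvPolynomial (Fin N) ℝ} {M : ℕ}
    (hp : p.IsHomogeneous M) (h : ∀ θ : Sph N, polyFun p θ = 0) : p = 0 := by
  refine hp.eq_zero_of_forall_eval_eq_zero fun r => ?_
  have hx : ∃ (c : ℝ) (θ : Sph N), WithLp.toLp 2 r = c • (θ : EuclideanSpace ℝ (Fin N)) := by
    by_cases h0 : WithLp.toLp 2 r = 0
    · refine ⟨0, ⟨EuclideanSpace.single 0 1, by simp⟩, by simp [h0]⟩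
    · refine ⟨‖WithLp.toLp 2 r‖, ⟨‖WithLp.toLp 2 r‖⁻¹ • WithLp.toLp 2 r, ?_⟩, ?_⟩
      · simp [norm_smul, norm_ne_zero_iff.2 h0]
      · simp [smul_smul, norm_ne_zero_iff.2 h0]
  obtain ⟨c, θ, hcθ⟩ := hx
  have := polyFun_smul hp c θ
  rw [h θ, mul_zero, ← hcθ] at this
  exact this

/-- Pairs of homogeneous polynomials of consecutive degrees, which parametrize the restrictions
to the sphere of polynomials of degree at most `M + 1`. -/
abbrev PairPoly (N M : ℕ) : Type := HomPoly N (M + 1) × HomPoly N M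

/-- The sum of the two components. -/
noncomputable def pairSum (N M : ℕ) : PairPoly N M →ₗ[ℝ] MvPolynomial (Fin N) ℝ :=
  (HomPoly N (M + 1)).subtype.coprod (HomPoly N M).subtype

theorem pairSum_apply {M : ℕ} (z : PairPoly N M) : pairSum N M z = z.1.1 + z.2.1 := rfl

/-- The negative spherical Laplacian acting on pairs. -/
noncomputable def pairLap (N M : ℕ) : PairPoly N M →ₗ[ℝ] PairPoly N M :=
  (sphLap.restrict fun _ hp => sphLap_isHomogeneous hp).prodMap
    (sphLap.restrict fun _ hp => sphLap_isHomogeneous hp)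

theorem pairSum_pairLap {M : ℕ} (z : PairPoly N M) :
    pairSum N M (pairLap N M z) = sphLap (pairSum N M z) := by
  rw [pairSum_apply, pairSum_apply, map_add]
  rfl

theorem pairSum_eq_zero_of_sph [NeZero N] {M : ℕ} {z : PairPoly N M}
    (h : ∀ θ : Sph N, polyFun (pairSum N M z) θ = 0) : z = 0 := by
  have key : ∀ θ : Sph N, polyFun z.1.1 θ = 0 ∧ polyFun z.2.1 θ = 0 := by
    intro θ
    have h1 := h θ
    have h2 := h (-θ)
    have e1 := polyFun_smul z.1.2 (-1) (θ : EuclideanSpace ℝ (Fin N))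
    have e2 := polyFun_smul z.2.2 (-1) (θ : EuclideanSpace ℝ (Fin N))
    rw [neg_one_smul] at e1 e2
    rw [pairSum_apply, polyFun_add] at h1 h2
    rw [coe_neg_sphere, e1, e2, pow_succ] at h2
    have h3 : (-1 : ℝ) ^ M * (polyFun z.2.1 θ - polyFun z.1.1 θ) = 0 := by linarith
    have h4 : polyFun z.2.1 θ - polyFun z.1.1 θ = 0 :=
      (mul_eq_zero.1 h3).resolve_left (pow_ne_zero _ (by norm_num))
    constructor <;> linarith
  ext1
  · exact Subtype.ext (eq_zero_of_polyFun_sph_eq_zero z.1.2 fun θ => (key θ).1)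
  · exact Subtype.ext (eq_zero_of_polyFun_sph_eq_zero z.2.2 fun θ => (key θ).2)

theorem exists_pairSum_eq_of_isHomogeneous {p : MvPolynomial (Fin N) ℝ} {d M : ℕ}
    (hp : p.IsHomogeneous d) (hd : d ≤ M + 1) :
    ∃ z : PairPoly N M, ∀ θ : Sph N, polyFun (pairSum N M z) θ = polyFun p θ := by
  rcases Nat.even_or_odd' (M + 1 - d) with ⟨a, ha | ha⟩
  · refine ⟨(⟨sqPoly N ^ a * p, ?_⟩, 0), fun θ => ?_⟩
    · have := (sqPoly_isHomogeneous.pow a).mul hp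
      rwa [show 2 * a + d = M + 1 by omega] at this
    · simp [pairSum_apply, polyFun_sqPoly_pow_mul]
  · refine ⟨(0, ⟨sqPoly N ^ a * p, ?_⟩), fun θ => ?_⟩
    · have := (sqPoly_isHomogeneous.pow a).mul hp
      rwa [show 2 * a + d = M by omega] at this
    · simp [pairSum_apply, polyFun_sqPoly_pow_mul]

theorem exists_pairSum_eq {p : MvPolynomial (Fin N) ℝ} {M : ℕ} (hp : p.totalDegree ≤ M + 1) :
    ∃ z : PairPoly N M, ∀ θ : Sph N, polyFun (pairSum N M z) θ = polyFun p θ := by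
  have h : ∀ d : ℕ, ∃ z : PairPoly N M, d ≤ M + 1 → ∀ θ : Sph N,
      polyFun (pairSum N M z) θ = polyFun (MvPolynomial.homogeneousComponent d p) θ := by
    intro d
    by_cases hd : d ≤ M + 1
    · obtain ⟨z, hz⟩ := exists_pairSum_eq_of_isHomogeneous
        (MvPolynomial.homogeneousComponent_isHomogeneous d p) hd
      exact ⟨z, fun _ => hz⟩
    · exact ⟨0, fun h => absurd h hd⟩
  choose z hz using h
  refine ⟨∑ d ∈ Finset.range (p.totalDegree + 1), z d, fun θ => ?_⟩
  conv_rhs => rw [← MvPolynomial.sum_homogeneousComponent p]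
  rw [map_sum, polyFun_sum, polyFun_sum]
  refine Finset.sum_congr rfl fun d hd => hz d ?_ θ
  have := Finset.mem_range.1 hd
  omega

theorem sphDir_comm (f g : EuclideanSpace ℝ (Fin N) → ℝ) : sphDir f g = sphDir g f := by
  simp only [sphDir, mul_comm]

theorem integrable_polyFun_mul (p q : MvPolynomial (Fin N) ℝ) :
    Integrable (fun θ : Sph N => polyFun p θ * polyFun q θ) (sphMeas N) :=
  integrable_sphMeas ((continuous_polyFun_sph p).mul (continuous_polyFun_sph q))

/-- A system of polynomials which restrict on the sphere to an orthonormal basis of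
eigenfunctions of the spherical Laplacian for the polynomials of degree at most `M + 1`. -/
structure IsSphBasis {ι : Type*} [Fintype ι] [DecidableEq ι] (M : ℕ)
    (Y : ι → MvPolynomial (Fin N) ℝ) (μ : ι → ℝ) : Prop where
  orthonormal : ∀ i j, ∫ θ : Sph N, polyFun (Y i) θ * polyFun (Y j) θ ∂sphMeas N =
    if i = j then 1 else 0
  eigen : ∀ i, sphLap (Y i) = μ i • Y i
  span : ∀ p : MvPolynomial (Fin N) ℝ, p.totalDegree ≤ M + 1 →
    ∃ c : ι → ℝ, ∀ θ : Sph N, polyFun p θ = ∑ i, c i * polyFun (Y i) θ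
  degree : ∀ i, ∃ (j : ℕ) (q : MvPolynomial (Fin N) ℝ), j ≤ M + 1 ∧ q.totalDegree ≤ j ∧
    μ i = sphEig N j ∧ ∀ θ : Sph N, polyFun (Y i) θ = polyFun q θ

theorem sphEig_strictMono (hN : 2 ≤ N) : StrictMono (sphEig N) := by
  refine strictMono_nat_of_lt_succ fun j => ?_
  have : (2 : ℝ) ≤ N := by exact_mod_cast hN
  have hj : (0 : ℝ) ≤ j := j.cast_nonneg
  simp only [sphEig]
  push_cast
  nlinarith

theorem pairSum_eigen_degree [NeZero N] (hN : 2 ≤ N) {M : ℕ} {z : PairPoly N M} (hz : z ≠ 0) {μ : ℝ}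
    (hμ : pairLap N M z = μ • z) :
    ∃ (j : ℕ) (q : MvPolynomial (Fin N) ℝ), j ≤ M + 1 ∧ q.totalDegree ≤ j ∧
      μ = sphEig N j ∧ ∀ θ : Sph N, polyFun (pairSum N M z) θ = polyFun q θ := by
  obtain ⟨⟨p, hp⟩, ⟨q, hq⟩⟩ := z
  have e1 : sphLap p = μ • p := congrArg (fun w : PairPoly N M => w.1.1) hμ
  have e2 : sphLap q = μ • q := congrArg (fun w : PairPoly N M => w.2.1) hμ
  have hsum : pairSum N M (⟨p, hp⟩, ⟨q, hq⟩) = p + q := rfl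
  by_cases hp0 : p = 0
  · have hq0 : q ≠ 0 := by
      rintro rfl
      subst hp0
      exact hz rfl
    obtain ⟨j, a, r, hj, hμj, hr, rfl⟩ := sphLap_eigenvector hq hq0 e2
    refine ⟨j, r, by omega, hr.totalDegree_le, hμj, fun θ => ?_⟩
    rw [hsum, hp0, zero_add, polyFun_sqPoly_pow_mul]
  · obtain ⟨j, a, r, hj, hμj, hr, rfl⟩ := sphLap_eigenvector hp hp0 e1
    by_cases hq0 : q = 0
    · refine ⟨j, r, by omega, hr.totalDegree_le, hμj, fun θ => ?_⟩
      rw [hsum, hq0, add_zero, polyFun_sqPoly_pow_mul]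
    · obtain ⟨j', a', r', hj', hμj', hr', rfl⟩ := sphLap_eigenvector hq hq0 e2
      have := (sphEig_strictMono hN).injective (hμj.symm.trans hμj')
      omega

theorem exists_isSphBasis [NeZero N] (hN : 2 ≤ N) (M : ℕ) :
    ∃ (Y : Fin (Module.finrank ℝ (PairPoly N M)) → MvPolynomial (Fin N) ℝ)
      (μ : Fin (Module.finrank ℝ (PairPoly N M)) → ℝ), IsSphBasis M Y μ := by
  let B : PairPoly N M →ₗ[ℝ] PairPoly N M →ₗ[ℝ] ℝ := LinearMap.mk₂ ℝ
    (fun z w => ∫ θ : Sph N, polyFun (pairSum N M z) θ * polyFun (pairSum N M w) θ ∂sphMeas N)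
    (fun z z' w => by
      simp only [map_add, polyFun_add, add_mul]
      exact integral_add (integrable_polyFun_mul _ _) (integrable_polyFun_mul _ _))
    (fun c z w => by
      simp only [map_smul, polyFun_smul_poly, mul_assoc, smul_eq_mul]
      exact integral_const_mul _ _)
    (fun z w w' => by
      simp only [map_add, polyFun_add, mul_add]
      exact integral_add (integrable_polyFun_mul _ _) (integrable_polyFun_mul _ _))
    (fun c z w => by
      simp only [map_smul, polyFun_smul_poly, mul_left_comm, smul_eq_mul]
      exact integral_const_mul _ _)
  have hB : ∀ z w, B z w =
      ∫ θ : Sph N, polyFun (pairSum N M z) θ * polyFun (pairSum N M w) θ ∂sphMeas N :=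
    fun _ _ => rfl
  have hsymm : ∀ z w, B z w = B w z := fun z w => by simp only [hB, mul_comm]
  have hpos : ∀ z, z ≠ 0 → 0 < B z z := by
    intro z hz
    obtain ⟨θ, hθ⟩ : ∃ θ : Sph N, polyFun (pairSum N M z) θ ≠ 0 := by
      by_contra! h
      exact hz (pairSum_eq_zero_of_sph h)
    exact integral_pos_of_integrable_nonneg_nonzero (x := θ)
      ((continuous_polyFun_sph _).mul (continuous_polyFun_sph _)) (integrable_polyFun_mul _ _)
      (fun θ => mul_self_nonneg _) (mul_self_ne_zero.2 hθ)
  have hT : ∀ z w, B (pairLap N M z) w = B z (pairLap N M w) := by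
    intro z w
    rw [hsymm]
    simp only [hB, pairSum_pairLap]
    rw [← sphDir_polyFun (contDiffOn_polyFun _), ← sphDir_polyFun (contDiffOn_polyFun _),
      sphDir_comm]
  obtain ⟨e, μ, he, hμ, hspan⟩ := exists_orthonormal_eigenvectors B hsymm hpos (pairLap N M) hT
  refine ⟨fun i => pairSum N M (e i), μ, he, fun i => ?_, fun p hp => ?_, fun i => ?_⟩
  · rw [← pairSum_pairLap, hμ, map_smul]
  · obtain ⟨z, hz⟩ := exists_pairSum_eq hp
    refine ⟨fun i => B (e i) z, fun θ => ?_⟩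
    rw [← hz θ]
    conv_lhs => rw [hspan z]
    simp only [map_sum, map_smul, polyFun_sum, polyFun_smul_poly]
  · refine pairSum_eigen_degree hN (fun h => ?_) (hμ i)
    have := he i i
    simp [h] at this

end SphericalPolynomials

section Bessel

variable {N : ℕ} {ι : Type*} [Fintype ι] {M : ℕ}
  {Y : ι → MvPolynomial (Fin N) ℝ} {μ : ι → ℝ}

/-- The coefficient of `f` along the polynomial `p` on the sphere. -/
noncomputable def sphCoef (f : EuclideanSpace ℝ (Fin N) → ℝ) (p : MvPolynomial (Fin N) ℝ) : ℝ :=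
  ∫ θ : Sph N, f θ * polyFun p θ ∂sphMeas N

theorem integral_sub_sq {X : Type*} [MeasurableSpace X] {ν : Measure X} {f g : X → ℝ}
    (hff : Integrable (fun x => f x * f x) ν) (hfg : Integrable (fun x => f x * g x) ν)
    (hgg : Integrable (fun x => g x * g x) ν) :
    ∫ x, (f x - g x) ^ 2 ∂ν =
      ∫ x, f x ^ 2 ∂ν - 2 * ∫ x, f x * g x ∂ν + ∫ x, g x ^ 2 ∂ν := by
  have e : ∀ x, (f x - g x) ^ 2 = f x * f x - 2 * (f x * g x) + g x * g x := fun x => by ring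
  simp only [e, sq]
  rw [integral_add (f := fun x => f x * f x - 2 * (f x * g x)) (hff.sub (hfg.const_mul 2)) hgg,
    integral_sub hff (hfg.const_mul 2), integral_const_mul]

theorem integral_mul_sum (c : ι → ℝ) {f : EuclideanSpace ℝ (Fin N) → ℝ}
    (hf : Continuous fun θ : Sph N => f θ) :
    ∫ θ : Sph N, f θ * ∑ i, c i * polyFun (Y i) θ ∂sphMeas N = ∑ i, c i * sphCoef f (Y i) := by
  simp only [Finset.mul_sum, mul_left_comm]
  rw [integral_finsetSum]
  · simp only [integral_const_mul, sphCoef]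
  · exact fun j _ => (integrable_sphMeas (hf.mul (continuous_polyFun_sph _))).const_mul _

/-- The squared distance of `f` to the span of `Y` in `L²` of the sphere. -/
noncomputable def sphRem (Y : ι → MvPolynomial (Fin N) ℝ) (f : EuclideanSpace ℝ (Fin N) → ℝ) : ℝ :=
  ∫ θ : Sph N, f θ ^ 2 ∂sphMeas N - ∑ i, sphCoef f (Y i) ^ 2

theorem sphRem_le_integral (Y : ι → MvPolynomial (Fin N) ℝ)
    (f : EuclideanSpace ℝ (Fin N) → ℝ) : sphRem Y f ≤ ∫ θ : Sph N, f θ ^ 2 ∂sphMeas N :=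
  sub_le_self _ (Finset.sum_nonneg fun _ _ => sq_nonneg _)

theorem polyFun_sum_smul (c : ι → ℝ) (Y : ι → MvPolynomial (Fin N) ℝ)
    (x : EuclideanSpace ℝ (Fin N)) :
    polyFun (∑ i, c i • Y i) x = ∑ i, c i * polyFun (Y i) x := by
  simp only [polyFun_sum, polyFun_smul_poly]

variable [DecidableEq ι]

theorem IsSphBasis.integral_sum_sq (hY : IsSphBasis M Y μ) (c : ι → ℝ) :
    ∫ θ : Sph N, (∑ i, c i * polyFun (Y i) θ) ^ 2 ∂sphMeas N = ∑ i, c i ^ 2 := by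
  have e : ∀ θ : Sph N, (∑ i, c i * polyFun (Y i) θ) ^ 2 =
      ∑ i, ∑ j, c i * c j * (polyFun (Y i) θ * polyFun (Y j) θ) := fun θ => by
    rw [sq, Finset.sum_mul_sum]
    exact Finset.sum_congr rfl fun i _ => Finset.sum_congr rfl fun j _ => by ring
  simp only [e]
  rw [integral_finsetSum]
  · refine Finset.sum_congr rfl fun i _ => ?_
    rw [integral_finsetSum]
    · simp only [integral_const_mul, hY.orthonormal]
      simp [sq]
    · exact fun j _ => (integrable_polyFun_mul _ _).const_mul _
  · exact fun i _ => integrable_finsetSum _ fun j _ => (integrable_polyFun_mul _ _).const_mul _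

theorem IsSphBasis.integral_sub_sum_sq (hY : IsSphBasis M Y μ) (c : ι → ℝ)
    {f : EuclideanSpace ℝ (Fin N) → ℝ} (hf : Continuous fun θ : Sph N => f θ) :
    ∫ θ : Sph N, (f θ - ∑ i, c i * polyFun (Y i) θ) ^ 2 ∂sphMeas N =
      ∫ θ : Sph N, f θ ^ 2 ∂sphMeas N - 2 * (∑ i, c i * sphCoef f (Y i)) + ∑ i, c i ^ 2 := by
  have hc : Continuous fun θ : Sph N => ∑ i, c i * polyFun (Y i) θ :=
    continuous_finsetSum _ fun i _ => (continuous_polyFun_sph _).const_mul _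
  rw [integral_sub_sq (integrable_sphMeas (hf.mul hf)) (integrable_sphMeas (hf.mul hc))
    (integrable_sphMeas (hc.mul hc)), hY.integral_sum_sq, integral_mul_sum c hf]

theorem IsSphBasis.sphRem_nonneg (hY : IsSphBasis M Y μ) {f : EuclideanSpace ℝ (Fin N) → ℝ}
    (hf : Continuous fun θ : Sph N => f θ) : 0 ≤ sphRem Y f := by
  have h := hY.integral_sub_sum_sq (fun i => sphCoef f (Y i)) hf
  have h0 : 0 ≤ ∫ θ : Sph N, (f θ - ∑ i, sphCoef f (Y i) * polyFun (Y i) θ) ^ 2 ∂sphMeas N :=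
    integral_nonneg fun θ => sq_nonneg _
  simp only [sphRem, sq] at *
  linarith

theorem IsSphBasis.sphRem_le (hY : IsSphBasis M Y μ) (c : ι → ℝ)
    {f : EuclideanSpace ℝ (Fin N) → ℝ} (hf : Continuous fun θ : Sph N => f θ) :
    sphRem Y f ≤ ∫ θ : Sph N, (f θ - ∑ i, c i * polyFun (Y i) θ) ^ 2 ∂sphMeas N := by
  rw [hY.integral_sub_sum_sq c hf, sphRem]
  have h : 0 ≤ ∑ i, (c i - sphCoef f (Y i)) ^ 2 := Finset.sum_nonneg fun i _ => sq_nonneg _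
  have e : ∑ i, (c i - sphCoef f (Y i)) ^ 2 =
      ∑ i, c i ^ 2 - 2 * (∑ i, c i * sphCoef f (Y i)) + ∑ i, sphCoef f (Y i) ^ 2 := by
    rw [Finset.mul_sum, ← Finset.sum_sub_distrib, ← Finset.sum_add_distrib]
    exact Finset.sum_congr rfl fun i _ => by ring
  linarith

theorem exists_polyFun_near {f : Sph N → ℝ} (hf : Continuous f) {ε : ℝ} (hε : 0 < ε) :
    ∃ p : MvPolynomial (Fin N) ℝ, ∀ θ : Sph N, |f θ - polyFun p θ| < ε := by
  let φ : MvPolynomial (Fin N) ℝ →ₐ[ℝ] C(Sph N, ℝ) := MvPolynomial.aeval fun i =>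
    ⟨fun θ : Sph N => (θ : EuclideanSpace ℝ (Fin N)) i, by fun_prop⟩
  have hφ : ∀ p (θ : Sph N), φ p θ = polyFun p θ := by
    intro p θ
    induction p using MvPolynomial.induction_on with
    | C c => simp [φ, polyFun]
    | add p q hp hq => simp [hp, hq, polyFun_add]
    | mul_X p j hp => rw [map_mul, ContinuousMap.mul_apply, hp]; simp [φ, polyFun]
  have hsep : φ.range.SeparatesPoints := by
    intro θ θ' hne
    obtain ⟨i, hi⟩ : ∃ i, (θ : EuclideanSpace ℝ (Fin N)) i ≠ (θ' : EuclideanSpace ℝ (Fin N)) i := by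
      by_contra! h
      exact hne (Subtype.ext (PiLp.ext h))
    refine ⟨_, ⟨φ (MvPolynomial.X i), ⟨_, rfl⟩, rfl⟩, ?_⟩
    simpa [hφ, polyFun] using hi
  obtain ⟨⟨g, p, hp⟩, hg⟩ :=
    ContinuousMap.exists_mem_subalgebra_near_continuous_of_separatesPoints φ.range hsep f hf ε hε
  refine ⟨p, fun θ => ?_⟩
  have h := hg θ
  rw [← hφ, abs_sub_comm]
  have e : φ p = g := hp
  rw [e]
  exact h

/-- Completeness of spherical harmonics. -/
theorem tendsto_sphRem {κ : ℕ → Type*} [∀ M, Fintype (κ M)] [∀ M, DecidableEq (κ M)]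
    {Z : ∀ M, κ M → MvPolynomial (Fin N) ℝ} {ν : ∀ M, κ M → ℝ}
    (hZ : ∀ M, IsSphBasis M (Z M) (ν M)) {f : EuclideanSpace ℝ (Fin N) → ℝ}
    (hf : Continuous fun θ : Sph N => f θ) :
    Tendsto (fun M => sphRem (Z M) f) atTop (𝓝 0) := by
  refine Metric.tendsto_atTop.2 fun ε hε => ?_
  set s : ℝ := (sphMeas N).real univ with hs
  have hs0 : 0 ≤ s := measureReal_nonneg
  obtain ⟨δ, hδ, hδε⟩ : ∃ δ > 0, s * δ ^ 2 < ε := by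
    refine ⟨Real.sqrt (ε / (s + 1)), Real.sqrt_pos.2 (by positivity), ?_⟩
    rw [Real.sq_sqrt (by positivity), ← mul_div_assoc, div_lt_iff₀ (by positivity)]
    nlinarith
  obtain ⟨p, hp⟩ := exists_polyFun_near hf hδ
  refine ⟨p.totalDegree, fun M hM => ?_⟩
  obtain ⟨c, hc⟩ := (hZ M).span p (by omega)
  rw [Real.dist_eq, sub_zero, abs_of_nonneg ((hZ M).sphRem_nonneg hf)]
  refine ((hZ M).sphRem_le c hf).trans_lt (lt_of_le_of_lt ?_ hδε)
  simp only [← hc]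
  calc ∫ θ : Sph N, (f θ - polyFun p θ) ^ 2 ∂sphMeas N
      ≤ ∫ _θ : Sph N, δ ^ 2 ∂sphMeas N := by
        refine integral_mono (integrable_sphMeas ((hf.sub (continuous_polyFun_sph p)).pow 2))
          (integrable_const _) fun θ => ?_
        exact sq_le_sq' (by linarith [(abs_lt.1 (hp θ)).1]) (abs_lt.1 (hp θ)).2.le
    _ = s * δ ^ 2 := by simp [hs]

theorem sphDir_self_nonneg (f : EuclideanSpace ℝ (Fin N) → ℝ) : 0 ≤ sphDir f f :=
  mul_nonneg (by norm_num) (Finset.sum_nonneg fun _ _ => Finset.sum_nonneg fun _ _ =>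
    integral_nonneg fun _ => mul_self_nonneg _)

theorem sphDir_sub_self {f g : EuclideanSpace ℝ (Fin N) → ℝ} (hf : ContDiffOn ℝ 1 f {x | x ≠ 0})
    (hg : ContDiffOn ℝ 1 g {x | x ≠ 0}) :
    sphDir (fun x => f x - g x) (fun x => f x - g x) =
      sphDir f f - 2 * sphDir f g + sphDir g g := by
  have e : ∀ a b (θ : Sph N), angDeriv a b (fun x => f x - g x) θ =
      angDeriv a b f θ - angDeriv a b g θ := fun a b θ => by
    rw [angDeriv, fderiv_fun_sub (hf.differentiableAt_ne_zero θ.ne_zero)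
      (hg.differentiableAt_ne_zero θ.ne_zero)]
    rfl
  have cf := fun a b => continuous_sph (continuousOn_angDeriv hf a b)
  have cg := fun a b => continuous_sph (continuousOn_angDeriv hg a b)
  have h : ∀ a b, ∫ θ : Sph N, angDeriv a b (fun x => f x - g x) θ *
      angDeriv a b (fun x => f x - g x) θ ∂sphMeas N =
      (∫ θ : Sph N, angDeriv a b f θ * angDeriv a b f θ ∂sphMeas N) -
      2 * (∫ θ : Sph N, angDeriv a b f θ * angDeriv a b g θ ∂sphMeas N) +
      ∫ θ : Sph N, angDeriv a b g θ * angDeriv a b g θ ∂sphMeas N := fun a b => by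
    have := integral_sub_sq (integrable_sphMeas ((cf a b).mul (cf a b)))
      (integrable_sphMeas ((cf a b).mul (cg a b))) (integrable_sphMeas ((cg a b).mul (cg a b)))
    simpa only [e, sq] using this
  simp only [sphDir, h, Finset.sum_add_distrib, Finset.sum_sub_distrib, ← Finset.mul_sum]
  ring

theorem IsSphBasis.sphDir_sum_right (hY : IsSphBasis M Y μ) (c : ι → ℝ)
    {f : EuclideanSpace ℝ (Fin N) → ℝ} (hf : ContDiffOn ℝ 1 f {x | x ≠ 0}) :
    sphDir f (polyFun (∑ i, c i • Y i)) = ∑ i, c i * μ i * sphCoef f (Y i) := by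
  have h : ∀ x, polyFun (sphLap (∑ i, c i • Y i)) x = ∑ i, (c i * μ i) * polyFun (Y i) x :=
    fun x => by simp only [map_sum, map_smul, hY.eigen, polyFun_sum, polyFun_smul_poly, mul_assoc]
  rw [sphDir_polyFun hf]
  simp only [h]
  rw [integral_mul_sum _ (continuous_sph hf.continuousOn)]

theorem IsSphBasis.sphCoef_sum (hY : IsSphBasis M Y μ) (c : ι → ℝ) (i : ι) :
    sphCoef (polyFun (∑ j, c j • Y j)) (Y i) = c i := by
  have h := integral_mul_sum (Y := Y) c (continuous_polyFun_sph (Y i))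
  simp only [← polyFun_sum_smul] at h
  simp only [sphCoef, mul_comm] at h ⊢
  rw [h]
  simp [hY.orthonormal]

theorem IsSphBasis.sphDir_sum (hY : IsSphBasis M Y μ) (c : ι → ℝ) :
    sphDir (polyFun (∑ i, c i • Y i)) (polyFun (∑ i, c i • Y i)) = ∑ i, μ i * c i ^ 2 := by
  rw [hY.sphDir_sum_right c (contDiffOn_polyFun _)]
  exact Finset.sum_congr rfl fun i _ => by rw [hY.sphCoef_sum]; ring

theorem IsSphBasis.sum_le_sphDir (hY : IsSphBasis M Y μ) {f : EuclideanSpace ℝ (Fin N) → ℝ}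
    (hf : ContDiffOn ℝ 1 f {x | x ≠ 0}) :
    ∑ i, μ i * sphCoef f (Y i) ^ 2 ≤ sphDir f f := by
  have h := sphDir_sub_self hf (contDiffOn_polyFun (∑ i, sphCoef f (Y i) • Y i))
  rw [hY.sphDir_sum, hY.sphDir_sum_right _ hf] at h
  have h0 := sphDir_self_nonneg (fun x => f x - polyFun (∑ i, sphCoef f (Y i) • Y i) x)
  have e : ∑ i, sphCoef f (Y i) * μ i * sphCoef f (Y i) = ∑ i, μ i * sphCoef f (Y i) ^ 2 :=
    Finset.sum_congr rfl fun i _ => by ring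
  rw [e] at h
  linarith

end Bessel

section Polar

variable {N : ℕ} {β : ℝ}

/-- The radius corresponding to `t = r^β / β`. -/
noncomputable def polRad (β t : ℝ) : ℝ := (β * t) ^ (1 / β)

theorem polRad_pos (hβ : 0 < β) {t : ℝ} (ht : 0 < t) : 0 < polRad β t :=
  Real.rpow_pos_of_pos (mul_pos hβ ht) _

theorem hasDerivAt_polRad (hβ : 0 < β) {t : ℝ} (ht : 0 < t) :
    HasDerivAt (polRad β) ((β * t) ^ (1 / β - 1)) t := by
  have h := ((hasDerivAt_id t).const_mul β).rpow_const (p := 1 / β)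
    (Or.inl (mul_pos hβ ht).ne')
  refine h.congr_deriv ?_
  simp only [id]
  field_simp

theorem polRad_rpow (hβ : 0 < β) {t : ℝ} (ht : 0 < t) (s : ℝ) :
    polRad β t ^ s = (β * t) ^ (s / β) := by
  rw [polRad, ← Real.rpow_mul (mul_pos hβ ht).le]
  congr 1
  ring

theorem polRad_image (hβ : 0 < β) : polRad β '' Ioi 0 = Ioi 0 := by
  ext r
  constructor
  · rintro ⟨t, ht, rfl⟩
    exact polRad_pos hβ ht
  · intro hr
    have hr' : 0 < r := hr
    refine ⟨r ^ β / β, div_pos (Real.rpow_pos_of_pos hr' _) hβ, ?_⟩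
    rw [polRad, mul_div_cancel₀ _ hβ.ne', ← Real.rpow_mul hr'.le, mul_one_div_cancel hβ.ne',
      Real.rpow_one]

theorem polRad_injOn (hβ : 0 < β) : InjOn (polRad β) (Ioi 0) := by
  intro s hs t ht h
  have h2 := congrArg (fun r => r ^ β) h
  simp only [polRad_rpow hβ hs, polRad_rpow hβ ht, div_self hβ.ne', Real.rpow_one] at h2
  exact mul_left_cancel₀ hβ.ne' h2

theorem lintegral_polar [NeZero N] (hβ : 0 < β) {f : EuclideanSpace ℝ (Fin N) → ENNReal}
    (hf : Measurable f) :
    ∫⁻ x, f x = ∫⁻ t in Ioi (0 : ℝ), ENNReal.ofReal ((β * t) ^ (N / β - 1)) *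
      ∫⁻ θ : Sph N, f (polRad β t • (θ : EuclideanSpace ℝ (Fin N))) ∂sphMeas N := by
  have : Nonempty (Fin N) := ⟨0⟩
  have hN : 1 ≤ N := Nat.one_le_iff_ne_zero.2 (NeZero.ne N)
  set g : ℝ → ENNReal := fun r => ∫⁻ θ : Sph N, f (r • (θ : EuclideanSpace ℝ (Fin N))) ∂sphMeas N
    with hg
  have hfm : Measurable fun z : Sph N × ℝ => f (z.2 • (z.1 : EuclideanSpace ℝ (Fin N))) := by
    fun_prop
  have hgm : Measurable g := hfm.lintegral_prod_left'
  have h1 : ∫⁻ x, f x = ∫⁻ r in Ioi (0 : ℝ), ENNReal.ofReal (r ^ (N - 1)) * g r := by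
    calc ∫⁻ x, f x = ∫⁻ x in ({0}ᶜ : Set (EuclideanSpace ℝ (Fin N))), f x := by
          rw [restrict_compl_singleton]
      _ = ∫⁻ x : ({0}ᶜ : Set (EuclideanSpace ℝ (Fin N))), f x
            ∂((volume : Measure (EuclideanSpace ℝ (Fin N))).comap Subtype.val) :=
          (lintegral_subtype_comap (measurableSet_singleton _).compl _).symm
      _ = ∫⁻ z : Sph N × Ioi (0 : ℝ), f (z.2.1 • (z.1 : EuclideanSpace ℝ (Fin N)))
            ∂((sphMeas N).prod (Measure.volumeIoiPow (N - 1))) := by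
          have h := (volume : Measure
            (EuclideanSpace ℝ (Fin N))).measurePreserving_homeomorphUnitSphereProd
          rw [finrank_euclideanSpace_fin] at h
          rw [← h.lintegral_comp_emb (Homeomorph.measurableEmbedding _)]
          refine lintegral_congr fun x => ?_
          have hx : (x : EuclideanSpace ℝ (Fin N)) ≠ 0 := x.2
          simp [smul_smul, norm_ne_zero_iff.2 hx]
      _ = ∫⁻ r : Ioi (0 : ℝ), g r ∂(Measure.volumeIoiPow (N - 1)) := by
          exact lintegral_prod_symm' (fun z : Sph N × Ioi (0 : ℝ) =>
            f (z.2.1 • (z.1 : EuclideanSpace ℝ (Fin N))))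
            (hfm.comp (measurable_id.prodMap measurable_subtype_coe))
      _ = ∫⁻ r in Ioi (0 : ℝ), ENNReal.ofReal (r ^ (N - 1)) * g r := by
          refine (lintegral_withDensity_eq_lintegral_mul _ (by fun_prop)
            (hgm.comp measurable_subtype_coe)).trans ?_
          exact lintegral_subtype_comap measurableSet_Ioi
            (fun r => ENNReal.ofReal (r ^ (N - 1)) * g r)
  rw [h1]
  conv_lhs => rw [← polRad_image hβ]
  rw [lintegral_image_eq_lintegral_abs_deriv_mul measurableSet_Ioi
    (fun t ht => (hasDerivAt_polRad hβ ht).hasDerivWithinAt) (polRad_injOn hβ)]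
  refine setLIntegral_congr_fun measurableSet_Ioi fun t ht => ?_
  have hβt : 0 < β * t := mul_pos hβ ht
  rw [← mul_assoc, ← ENNReal.ofReal_mul (abs_nonneg _), abs_of_pos (Real.rpow_pos_of_pos hβt _),
    ← Real.rpow_natCast, polRad_rpow hβ ht, ← Real.rpow_add hβt]
  congr 3
  rw [Nat.cast_sub hN]
  push_cast
  ring

/-- Polar coordinates `(t, θ) ↦ r θ` with `t = r^β / β`. -/
noncomputable def polMap (β : ℝ) (z : ℝ × Sph N) : EuclideanSpace ℝ (Fin N) :=
  polRad β z.1 • (z.2 : EuclideanSpace ℝ (Fin N))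

/-- The product measure on `(0,∞) × S`. -/
noncomputable abbrev polMeas (N : ℕ) : Measure (ℝ × Sph N) :=
  ((volume : Measure ℝ).restrict (Ioi 0)).prod (sphMeas N)

theorem measurable_polRad : Measurable (polRad β) := by
  unfold polRad
  fun_prop

theorem measurable_polMap : Measurable (polMap (N := N) β) :=
  (measurable_polRad.comp measurable_fst).smul (measurable_subtype_coe.comp measurable_snd)

theorem map_polMap [NeZero N] (hβ : 0 < β) :
    ((polMeas N).withDensity fun z => ENNReal.ofReal ((β * z.1) ^ (N / β - 1))).map (polMap β) =
      (volume : Measure (EuclideanSpace ℝ (Fin N))) := by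
  refine Measure.ext_of_lintegral _ fun f hf => ?_
  have hm : Measurable fun z : ℝ × Sph N => ENNReal.ofReal ((β * z.1) ^ (N / β - 1)) := by
    fun_prop
  rw [lintegral_map hf measurable_polMap, lintegral_polar hβ hf]
  refine (lintegral_withDensity_eq_lintegral_mul _ hm (hf.comp measurable_polMap)).trans ?_
  rw [lintegral_prod _ (hm.mul (hf.comp measurable_polMap)).aemeasurable]
  refine lintegral_congr fun t => ?_
  exact lintegral_const_mul (ENNReal.ofReal ((β * t) ^ (N / β - 1)))
    (hf.comp ((measurable_polMap (N := N) (β := β)).comp (measurable_prodMk_left (x := t))))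

theorem ae_polMeas : ∀ᵐ z ∂polMeas N, 0 < z.1 :=
  Measure.quasiMeasurePreserving_fst.ae (ae_restrict_mem measurableSet_Ioi)

theorem norm_polMap (hβ : 0 < β) {z : ℝ × Sph N} (hz : 0 < z.1) :
    ‖polMap β z‖ = polRad β z.1 := by
  rw [polMap, norm_smul, z.2.norm_eq, mul_one, Real.norm_of_nonneg (polRad_pos hβ hz).le]

variable {α : ℝ}

theorem polar_weight (hα : 0 < α) {z : ℝ × Sph N} (hz : 0 < z.1) :
    ((1 + α / 2) * z.1) ^ (N / (1 + α / 2) - 1) * ‖polMap (1 + α / 2) z‖ ^ α =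
      (1 + α / 2) ^ kk N α * z.1 ^ kk N α := by
  have hβ : 0 < 1 + α / 2 := by positivity
  rw [norm_polMap hβ hz, polRad_rpow hβ hz, ← Real.rpow_add (mul_pos hβ hz),
    ← Real.mul_rpow hβ.le hz.le]
  congr 1
  rw [kk]
  field_simp
  ring

theorem integrable_and_integral_polar [NeZero N] (hα : 0 < α) {G : EuclideanSpace ℝ (Fin N) → ℝ}
    (hG : AEStronglyMeasurable G) :
    (Integrable (fun x => ‖x‖ ^ α * G x) ↔
      Integrable (fun z => z.1 ^ kk N α * G (polMap (1 + α / 2) z)) (polMeas N)) ∧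
    ∫ x, ‖x‖ ^ α * G x =
      (1 + α / 2) ^ kk N α * ∫ z, z.1 ^ kk N α * G (polMap (1 + α / 2) z) ∂polMeas N := by
  have hβ : 0 < 1 + α / 2 := by positivity
  have hm : Measurable fun z : ℝ × Sph N =>
      ENNReal.ofReal (((1 + α / 2) * z.1) ^ (N / (1 + α / 2) - 1)) := by fun_prop
  have hGm : AEStronglyMeasurable (fun x : EuclideanSpace ℝ (Fin N) => ‖x‖ ^ α * G x) :=
    (Measurable.aestronglyMeasurable (by fun_prop)).mul hG
  have h0 := hGm
  rw [← map_polMap hβ] at h0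
  have h1 := integrable_map_measure h0 measurable_polMap.aemeasurable
  have h2 := integral_map measurable_polMap.aemeasurable h0
  rw [map_polMap hβ] at h1 h2
  rw [integrable_withDensity_iff_integrable_smul' hm (by simp)] at h1
  rw [integral_withDensity_eq_integral_toReal_smul hm (by simp)] at h2
  have hc : (1 + α / 2) ^ kk N α ≠ 0 := (Real.rpow_pos_of_pos hβ _).ne'
  have e : (fun z : ℝ × Sph N =>
      (ENNReal.ofReal (((1 + α / 2) * z.1) ^ (N / (1 + α / 2) - 1))).toReal •
        (‖polMap (1 + α / 2) z‖ ^ α * G (polMap (1 + α / 2) z))) =ᵐ[polMeas N]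
      fun z => (1 + α / 2) ^ kk N α * (z.1 ^ kk N α * G (polMap (1 + α / 2) z)) := by
    filter_upwards [ae_polMeas] with z hz
    rw [ENNReal.toReal_ofReal (Real.rpow_pos_of_pos (mul_pos hβ hz) _).le, smul_eq_mul,
      ← mul_assoc, polar_weight hα hz, mul_assoc]
  constructor
  · rw [h1, ← integrable_const_mul_iff hc.isUnit (fun z : ℝ × Sph N =>
      z.1 ^ kk N α * G (polMap (1 + α / 2) z))]
    exact integrable_congr e
  · rw [h2, ← integral_const_mul]
    exact integral_congr_ae e

end Polar

section Gradient

variable {N : ℕ} {α : ℝ}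

/-- Lagrange's identity for a linear form and the rotation fields. -/
theorem norm_sq_mul_norm_sq_eq (L : EuclideanSpace ℝ (Fin N) →L[ℝ] ℝ)
    (x : EuclideanSpace ℝ (Fin N)) :
    ‖x‖ ^ 2 * ‖L‖ ^ 2 = L x ^ 2 + 1 / 2 * ∑ a, ∑ b, L (rotField a b x) ^ 2 := by
  obtain ⟨g, rfl⟩ := (InnerProductSpace.toDual ℝ (EuclideanSpace ℝ (Fin N))).surjective L
  have hrot : ∀ a b, (InnerProductSpace.toDual ℝ (EuclideanSpace ℝ (Fin N)) g) (rotField a b x) =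
      x a * g b - x b * g a := fun a b => by
    rw [rotField_apply, map_sub, map_smul, map_smul]
    simp [InnerProductSpace.toDual_apply_apply, EuclideanSpace.inner_single_right]
  have hx : (InnerProductSpace.toDual ℝ (EuclideanSpace ℝ (Fin N)) g) x = ∑ i, x i * g i := by
    rw [InnerProductSpace.toDual_apply_apply]
    simp [PiLp.inner_apply]
  simp only [hrot, hx]
  rw [LinearIsometryEquiv.norm_map, EuclideanSpace.norm_sq_eq, EuclideanSpace.norm_sq_eq]
  simp only [Real.norm_eq_abs, sq_abs]
  have e : ∀ a b, (x a * g b - x b * g a) ^ 2 =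
      x a ^ 2 * g b ^ 2 + g a ^ 2 * x b ^ 2 - 2 * ((x a * g a) * (x b * g b)) :=
    fun a b => by ring
  simp only [e, Finset.sum_sub_distrib, Finset.sum_add_distrib, ← Finset.mul_sum,
    ← Finset.sum_mul]
  ring

/-- The derivative of `w (polMap β (t, θ))` in `t`. -/
noncomputable def polDt (β : ℝ) (w : EuclideanSpace ℝ (Fin N) → ℝ) (z : ℝ × Sph N) : ℝ :=
  fderiv ℝ w (polMap β z) ((β * z.1) ^ (1 / β - 1) • (z.2 : EuclideanSpace ℝ (Fin N)))

/-- The energy density of `w` along the spheres. -/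
noncomputable def polAng (β : ℝ) (w : EuclideanSpace ℝ (Fin N) → ℝ) (z : ℝ × Sph N) : ℝ :=
  1 / 2 * ∑ a, ∑ b, angDeriv a b w (polMap β z) ^ 2

theorem polAng_nonneg (β : ℝ) (w : EuclideanSpace ℝ (Fin N) → ℝ) (z : ℝ × Sph N) :
    0 ≤ polAng β w z :=
  mul_nonneg (by norm_num) (Finset.sum_nonneg fun _ _ => Finset.sum_nonneg fun _ _ => sq_nonneg _)

theorem norm_fderiv_sq_polMap (hα : 0 < α) (w : EuclideanSpace ℝ (Fin N) → ℝ) {z : ℝ × Sph N}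
    (hz : 0 < z.1) :
    ‖polMap (1 + α / 2) z‖ ^ (-α) * ‖fderiv ℝ w (polMap (1 + α / 2) z)‖ ^ 2 =
      polDt (1 + α / 2) w z ^ 2 + 1 / ((1 + α / 2) * z.1) ^ 2 * polAng (1 + α / 2) w z := by
  set β := 1 + α / 2 with hβdef
  have hβ : 0 < β := by positivity
  have hβz : 0 < β * z.1 := mul_pos hβ hz
  have hr := polRad_pos hβ hz
  have h := norm_sq_mul_norm_sq_eq (fderiv ℝ w (polMap β z)) (polMap β z)
  have hD : (β * z.1) * polDt β w z = fderiv ℝ w (polMap β z) (polMap β z) := by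
    rw [polDt]
    conv_rhs => rw [polMap]
    rw [map_smul, map_smul, smul_eq_mul, smul_eq_mul, ← mul_assoc, polRad]
    congr 1
    conv_lhs => rw [← Real.rpow_one (β * z.1)]
    rw [Real.rpow_one, mul_comm, ← Real.rpow_add_one hβz.ne']
    congr 1
    ring
  have hw : ‖polMap β z‖ ^ (-α) = ‖polMap β z‖ ^ 2 / (β * z.1) ^ 2 := by
    rw [norm_polMap hβ hz, ← Real.rpow_natCast, polRad_rpow hβ hz, polRad_rpow hβ hz,
      eq_div_iff (by positivity), ← Real.rpow_natCast, ← Real.rpow_add hβz]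
    congr 1
    rw [hβdef]
    field_simp
    push_cast
    ring
  rw [hw, div_mul_eq_mul_div, h, ← hD, polAng]
  simp only [angDeriv]
  field_simp

theorem arg_polMap (hα : 0 < α) {z : ℝ × Sph N} (hz : 0 < z.1) :
    2 / (2 + α) * ‖polMap (1 + α / 2) z‖ ^ ((2 + α) / 2) = z.1 := by
  have hβ : 0 < 1 + α / 2 := by positivity
  rw [norm_polMap hβ hz, polRad_rpow hβ hz,
    show (2 + α) / 2 / (1 + α / 2) = 1 by field_simp, Real.rpow_one]
  field_simp

theorem aestronglyMeasurable_of_continuousOn [NeZero N] {G : EuclideanSpace ℝ (Fin N) → ℝ}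
    (hG : ContinuousOn G {x | x ≠ 0}) : AEStronglyMeasurable G := by
  have : Nonempty (Fin N) := ⟨0⟩
  have h := hG.aestronglyMeasurable (μ := volume) (measurableSet_singleton 0).compl
  have e : ({x | x ≠ 0} : Set (EuclideanSpace ℝ (Fin N))) = {0}ᶜ := rfl
  rwa [e, restrict_compl_singleton] at h

theorem continuousOn_fderiv_weight {w : EuclideanSpace ℝ (Fin N) → ℝ}
    (hw : ContDiffOn ℝ 1 w {x | x ≠ 0}) :
    ContinuousOn (fun x => ‖x‖ ^ (-α) * ‖fderiv ℝ w x‖ ^ 2) {x | x ≠ 0} := by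
  refine ContinuousOn.mul ?_ ((hw.continuousOn_fderiv_of_isOpen isOpen_ne le_rfl).norm.pow 2)
  exact continuous_norm.continuousOn.rpow_const fun x hx => Or.inl (norm_ne_zero_iff.2 hx)

theorem ae_ne_zero [NeZero N] : ∀ᵐ x : EuclideanSpace ℝ (Fin N), x ≠ 0 := by
  have : Nonempty (Fin N) := ⟨0⟩
  exact Measure.ae_ne _ _

theorem weight_cancel {x : EuclideanSpace ℝ (Fin N)} (hx : x ≠ 0) :
    ‖x‖ ^ α * ‖x‖ ^ (-α) = 1 := by
  rw [← Real.rpow_add (norm_pos_iff.2 hx), add_neg_cancel, Real.rpow_zero]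

theorem dmem_iff_polar [NeZero N] (hα : 0 < α) {w : EuclideanSpace ℝ (Fin N) → ℝ}
    (hw : ContDiffOn ℝ 1 w {x | x ≠ 0}) :
    Dmem N α w ↔
      Integrable (fun z => z.1 ^ kk N α * w (polMap (1 + α / 2) z) ^ 2) (polMeas N) ∧
      Integrable (fun z => z.1 ^ kk N α * (polDt (1 + α / 2) w z ^ 2 +
        1 / ((1 + α / 2) * z.1) ^ 2 * polAng (1 + α / 2) w z)) (polMeas N) := by
  have h1 := (integrable_and_integral_polar hα (G := fun x => w x ^ 2)
    (aestronglyMeasurable_of_continuousOn (hw.continuousOn.pow 2))).1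
  have h2 := (integrable_and_integral_polar hα (aestronglyMeasurable_of_continuousOn
    (continuousOn_fderiv_weight (α := α) hw))).1
  have e1 : (fun x => ‖x‖ ^ α * (‖x‖ ^ (-α) * ‖fderiv ℝ w x‖ ^ 2)) =ᵐ[volume]
      fun x => ‖fderiv ℝ w x‖ ^ 2 := by
    filter_upwards [ae_ne_zero] with x hx
    rw [← mul_assoc, weight_cancel hx, one_mul]
  have e2 : (fun z : ℝ × Sph N => z.1 ^ kk N α * (‖polMap (1 + α / 2) z‖ ^ (-α) *
      ‖fderiv ℝ w (polMap (1 + α / 2) z)‖ ^ 2)) =ᵐ[polMeas N]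
      fun z => z.1 ^ kk N α * (polDt (1 + α / 2) w z ^ 2 +
        1 / ((1 + α / 2) * z.1) ^ 2 * polAng (1 + α / 2) w z) := by
    filter_upwards [ae_polMeas] with z hz
    rw [norm_fderiv_sq_polMap hα w hz]
  rw [integrable_congr e1, integrable_congr e2] at h2
  rw [Dmem, ← h1, ← h2]
  exact ⟨fun h => h.2, fun h => ⟨hw, h⟩⟩

theorem qform_polar [NeZero N] (hα : 0 < α) {w : EuclideanSpace ℝ (Fin N) → ℝ}
    (hw : ContDiffOn ℝ 1 w {x | x ≠ 0}) {A : ℝ → ℝ} (hA : ContinuousOn A (Ioi 0)) :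
    Qform N α (fun x => A (2 / (2 + α) * ‖x‖ ^ ((2 + α) / 2))) w =
      (1 + α / 2) ^ kk N α * ∫ z, z.1 ^ kk N α * (polDt (1 + α / 2) w z ^ 2 +
        1 / ((1 + α / 2) * z.1) ^ 2 * polAng (1 + α / 2) w z -
        A z.1 * w (polMap (1 + α / 2) z) ^ 2) ∂polMeas N := by
  have hAc : ContinuousOn (fun x : EuclideanSpace ℝ (Fin N) =>
      A (2 / (2 + α) * ‖x‖ ^ ((2 + α) / 2))) {x | x ≠ 0} := by
    refine hA.comp (continuousOn_const.mul (continuous_norm.continuousOn.rpow_const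
      fun x hx => Or.inl (norm_ne_zero_iff.2 hx))) fun x hx => ?_
    have : 0 < ‖x‖ := norm_pos_iff.2 hx
    exact mem_Ioi.2 (by positivity)
  have h := (integrable_and_integral_polar hα (aestronglyMeasurable_of_continuousOn
    ((continuousOn_fderiv_weight (α := α) hw).sub (hAc.mul (hw.continuousOn.pow 2))))).2
  have e1 : (fun x => ‖x‖ ^ α * (‖x‖ ^ (-α) * ‖fderiv ℝ w x‖ ^ 2 -
      A (2 / (2 + α) * ‖x‖ ^ ((2 + α) / 2)) * w x ^ 2)) =ᵐ[volume]
      fun x => ‖fderiv ℝ w x‖ ^ 2 -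
        ‖x‖ ^ α * A (2 / (2 + α) * ‖x‖ ^ ((2 + α) / 2)) * w x ^ 2 := by
    filter_upwards [ae_ne_zero] with x hx
    rw [mul_sub, ← mul_assoc, weight_cancel hx, one_mul, mul_assoc]
  have e2 : (fun z : ℝ × Sph N => z.1 ^ kk N α * (‖polMap (1 + α / 2) z‖ ^ (-α) *
      ‖fderiv ℝ w (polMap (1 + α / 2) z)‖ ^ 2 -
      A (2 / (2 + α) * ‖polMap (1 + α / 2) z‖ ^ ((2 + α) / 2)) *
        w (polMap (1 + α / 2) z) ^ 2)) =ᵐ[polMeas N]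
      fun z => z.1 ^ kk N α * (polDt (1 + α / 2) w z ^ 2 +
        1 / ((1 + α / 2) * z.1) ^ 2 * polAng (1 + α / 2) w z -
        A z.1 * w (polMap (1 + α / 2) z) ^ 2) := by
    filter_upwards [ae_polMeas] with z hz
    rw [norm_fderiv_sq_polMap hα w hz, arg_polMap hα hz]
  rw [Qform, ← integral_congr_ae e1, ← integral_congr_ae e2]
  exact h

end Gradient

section Radial

theorem integral_eq_zero_of_integrableOn_div {f f' : ℝ → ℝ}
    (hf : ∀ t > 0, HasDerivAt f (f' t) t) (hf' : IntegrableOn f' (Ioi 0))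
    (hdiv : IntegrableOn (fun t => t⁻¹ * f t) (Ioi 0)) : ∫ t in Ioi (0 : ℝ), f' t = 0 := by
  have himg : Real.exp '' univ = Ioi 0 := by rw [image_univ, Real.range_exp]
  have hder : ∀ x ∈ (univ : Set ℝ), HasDerivWithinAt Real.exp (Real.exp x) univ x :=
    fun x _ => (Real.hasDerivAt_exp x).hasDerivWithinAt
  rw [← himg, integral_image_eq_integral_abs_deriv_smul MeasurableSet.univ hder
    Real.exp_injective.injOn, setIntegral_univ]
  rw [← himg, integrableOn_image_iff_integrableOn_abs_deriv_smul MeasurableSet.univ hder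
    Real.exp_injective.injOn, integrableOn_univ] at hf' hdiv
  refine integral_eq_zero_of_hasDerivAt_of_integrable (f := fun x => f (Real.exp x))
    (fun x => ?_) hf' ?_
  · have h := (hf _ (Real.exp_pos x)).comp x (Real.hasDerivAt_exp x)
    refine h.congr_deriv ?_
    rw [abs_of_pos (Real.exp_pos x), smul_eq_mul, mul_comm]
  · refine hdiv.congr (Eventually.of_forall fun x => ?_)
    simp only [abs_of_pos (Real.exp_pos x), smul_eq_mul]
    rw [mul_inv_cancel_left₀ (Real.exp_pos x).ne']

theorem integrableOn_weight_mul {p f g : ℝ → ℝ} (hp : ∀ t > 0, 0 ≤ p t)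
    (hpc : ContinuousOn p (Ioi 0)) (hfc : ContinuousOn f (Ioi 0)) (hgc : ContinuousOn g (Ioi 0))
    (hf : IntegrableOn (fun t => p t * f t ^ 2) (Ioi 0))
    (hg : IntegrableOn (fun t => p t * g t ^ 2) (Ioi 0)) :
    IntegrableOn (fun t => p t * (f t * g t)) (Ioi 0) := by
  refine Integrable.mono' (hf.add hg)
    ((hpc.mul (hfc.mul hgc)).aestronglyMeasurable measurableSet_Ioi) ?_
  refine (ae_restrict_iff' measurableSet_Ioi).2 (Eventually.of_forall fun t ht => ?_)
  have h := hp t ht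
  rw [Real.norm_eq_abs, abs_mul, abs_of_nonneg h, Pi.add_apply, ← mul_add]
  refine mul_le_mul_of_nonneg_left ?_ h
  rw [abs_le]
  constructor <;> nlinarith [sq_nonneg (f t + g t), sq_nonneg (f t - g t), sq_nonneg (f t),
    sq_nonneg (g t)]

theorem continuousOn_rpow_Ioi (s : ℝ) : ContinuousOn (fun t : ℝ => t ^ s) (Ioi 0) :=
  continuousOn_id.rpow_const fun _ ht => Or.inl (ne_of_gt ht)

namespace memE

variable {k : ℝ} {f g : ℝ → ℝ}

theorem hasDerivAt (hf : memE k f) {t : ℝ} (ht : 0 < t) : HasDerivAt f (deriv f t) t :=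
  ((hf.1.differentiableOn one_ne_zero t ht).differentiableAt (Ioi_mem_nhds ht)).hasDerivAt

theorem continuousOn (hf : memE k f) : ContinuousOn f (Ioi 0) := hf.1.continuousOn

theorem continuousOn_deriv (hf : memE k f) : ContinuousOn (deriv f) (Ioi 0) :=
  hf.1.continuousOn_deriv_of_isOpen isOpen_Ioi le_rfl

theorem integrableOn_sq (hf : memE k f) : IntegrableOn (fun t => t ^ k * f t ^ 2) (Ioi 0) := by
  refine Integrable.mono' hf.2 (((continuousOn_rpow_Ioi k).mul
    (hf.continuousOn.pow 2)).aestronglyMeasurable measurableSet_Ioi) ?_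
  refine (ae_restrict_iff' measurableSet_Ioi).2 (Eventually.of_forall fun t ht => ?_)
  have := Real.rpow_nonneg (le_of_lt (mem_Ioi.1 ht)) k
  rw [Real.norm_of_nonneg (by positivity)]
  exact mul_le_mul_of_nonneg_left (le_add_of_nonneg_left (sq_nonneg _)) this

theorem integrableOn_deriv_sq (hf : memE k f) :
    IntegrableOn (fun t => t ^ k * deriv f t ^ 2) (Ioi 0) := by
  refine Integrable.mono' hf.2 (((continuousOn_rpow_Ioi k).mul
    (hf.continuousOn_deriv.pow 2)).aestronglyMeasurable measurableSet_Ioi) ?_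
  refine (ae_restrict_iff' measurableSet_Ioi).2 (Eventually.of_forall fun t ht => ?_)
  have := Real.rpow_nonneg (le_of_lt (mem_Ioi.1 ht)) k
  rw [Real.norm_of_nonneg (by positivity)]
  exact mul_le_mul_of_nonneg_left (le_add_of_nonneg_right (sq_nonneg _)) this

theorem hasDerivAt_comb (hf : memE k f) (hg : memE k g) (a b : ℝ) {t : ℝ} (ht : 0 < t) :
    HasDerivAt (fun t => a * f t + b * g t) (a * deriv f t + b * deriv g t) t :=
  ((hf.hasDerivAt ht).const_mul a).add ((hg.hasDerivAt ht).const_mul b)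

theorem integrableOn_mul (hf : memE k f) (hg : memE k g) :
    IntegrableOn (fun t => t ^ k * (f t * g t)) (Ioi 0) :=
  integrableOn_weight_mul (fun _ ht => Real.rpow_nonneg (le_of_lt ht) k) (continuousOn_rpow_Ioi k)
    hf.continuousOn hg.continuousOn hf.integrableOn_sq hg.integrableOn_sq

theorem integrableOn_deriv_mul (hf : memE k f) (hg : memE k g) :
    IntegrableOn (fun t => t ^ k * (deriv f t * deriv g t)) (Ioi 0) :=
  integrableOn_weight_mul (fun _ ht => Real.rpow_nonneg (le_of_lt ht) k) (continuousOn_rpow_Ioi k)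
    hf.continuousOn_deriv hg.continuousOn_deriv hf.integrableOn_deriv_sq hg.integrableOn_deriv_sq

/-- Hardy's inequality, in its qualitative form. -/
theorem integrableOn_hardy (hk : 1 < k) (hf : memE k f) :
    IntegrableOn (fun t => t ^ (k - 2) * f t ^ 2) (Ioi 0) := by
  have hc : ContinuousOn (fun t => t ^ (k - 2) * f t ^ 2) (Ioi 0) :=
    (continuousOn_rpow_Ioi _).mul (hf.continuousOn.pow 2)
  have hdc : ContinuousOn (fun t => t ^ k * deriv f t ^ 2) (Ioi 0) :=
    (continuousOn_rpow_Ioi _).mul (hf.continuousOn_deriv.pow 2)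
  rw [← Ioc_union_Ioi_eq_Ioi (zero_le_one : (0 : ℝ) ≤ 1)]
  refine IntegrableOn.union ?_ ?_
  · have hsub : ∀ a > (0 : ℝ), a ≤ 1 → uIcc a 1 ⊆ Ioi 0 := fun a ha ha1 t ht => by
      rw [uIcc_of_le ha1] at ht
      exact lt_of_lt_of_le ha ht.1
    have hII : ∀ {u : ℝ → ℝ}, ContinuousOn u (Ioi 0) → ∀ a > (0 : ℝ), a ≤ 1 →
        IntervalIntegrable u volume a 1 := fun hu a ha ha1 =>
      (hu.mono (hsub a ha ha1)).intervalIntegrable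
    set C := ∫ t in Ioi (0 : ℝ), t ^ k * deriv f t ^ 2
    have hx : Tendsto (fun n : ℕ => 1 / ((n : ℝ) + 1)) atTop (𝓝 0) :=
      tendsto_one_div_add_atTop_nhds_zero_nat
    refine integrableOn_Ioc_of_intervalIntegral_norm_bounded_left
      (I := 2 / (k - 1) * (f 1 ^ 2 + 2 / (k - 1) * C)) (l := atTop)
      (a := fun n : ℕ => 1 / ((n : ℝ) + 1)) (fun n => ?_) hx (Eventually.of_forall fun n => ?_)
    · exact ((hc.mono fun t ht => lt_of_lt_of_le (by positivity) ht.1 :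
        ContinuousOn _ (Icc (1 / ((n : ℝ) + 1)) 1)).integrableOn_Icc).mono_set Ioc_subset_Icc_self
    · have ha : 0 < 1 / ((n : ℝ) + 1) := by positivity
      have ha1 : 1 / ((n : ℝ) + 1) ≤ 1 := by
        rw [div_le_one (by positivity)]
        linarith [(Nat.cast_nonneg n : (0 : ℝ) ≤ n)]
      set a := 1 / ((n : ℝ) + 1)
      have hk1 : 0 < k - 1 := by linarith
      have hpos : ∀ t ∈ Icc a 1, (0 : ℝ) < t := fun t ht => lt_of_lt_of_le ha ht.1
      have hg : ∀ t ∈ uIcc a 1, HasDerivAt (fun t => t ^ (k - 1) * f t ^ 2)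
          ((k - 1) * (t ^ (k - 2) * f t ^ 2) + 2 * (t ^ (k - 1) * (f t * deriv f t))) t := by
        intro t ht
        have ht0 : 0 < t := hsub a ha ha1 ht
        have h := (Real.hasDerivAt_rpow_const (p := k - 1) (Or.inl ht0.ne')).mul
          ((hf.hasDerivAt ht0).pow 2)
        refine h.congr_deriv ?_
        rw [show k - 1 - 1 = k - 2 by ring, Pi.pow_apply]
        push_cast
        ring
      have hgi : ContinuousOn (fun t => (k - 1) * (t ^ (k - 2) * f t ^ 2) +
          2 * (t ^ (k - 1) * (f t * deriv f t))) (Ioi 0) :=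
        (continuousOn_const.mul hc).add (continuousOn_const.mul ((continuousOn_rpow_Ioi _).mul
          (hf.continuousOn.mul hf.continuousOn_deriv)))
      have hftc := intervalIntegral.integral_eq_sub_of_hasDerivAt hg (hII hgi a ha ha1)
      have hmono : ∫ t in a..1, (k - 1) / 2 * (t ^ (k - 2) * f t ^ 2) ≤
          ∫ t in a..1, ((k - 1) * (t ^ (k - 2) * f t ^ 2) +
            2 * (t ^ (k - 1) * (f t * deriv f t)) + 2 / (k - 1) * (t ^ k * deriv f t ^ 2)) := by
        refine intervalIntegral.integral_mono_on ha1
          (hII (continuousOn_const.mul hc) a ha ha1)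
          (hII (hgi.add (continuousOn_const.mul hdc)) a ha ha1) fun t ht => ?_
        have ht0 := hpos t ht
        have e1 : t ^ (k - 1) = t * t ^ (k - 2) := by
          rw [show k - 1 = k - 2 + 1 by ring, Real.rpow_add_one ht0.ne', mul_comm]
        have e2 : t ^ k = t ^ 2 * t ^ (k - 2) := by
          rw [show k = k - 2 + (2 : ℕ) by push_cast; ring, Real.rpow_add_natCast ht0.ne', mul_comm]
          ring_nf
        have hsq : 0 ≤ t ^ (k - 2) * ((k - 1) * f t + 2 * (t * deriv f t)) ^ 2 / (2 * (k - 1)) := by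
          have := Real.rpow_nonneg ht0.le (k - 2)
          positivity
        rw [e1, e2, ← sub_nonneg]
        refine hsq.trans_eq ?_
        field_simp
        ring
      rw [intervalIntegral.integral_add (hII hgi a ha ha1)
        ((hII hdc a ha ha1).const_mul _), hftc, intervalIntegral.integral_const_mul,
        intervalIntegral.integral_const_mul] at hmono
      have hC : ∫ t in a..1, t ^ k * deriv f t ^ 2 ≤ C := by
        rw [intervalIntegral.integral_of_le ha1]
        refine setIntegral_mono_set hf.integrableOn_deriv_sq ?_
          (Eventually.of_forall fun t ht => lt_trans ha ht.1)
        refine (ae_restrict_iff' measurableSet_Ioi).2 (Eventually.of_forall fun t ht => ?_)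
        exact mul_nonneg (Real.rpow_nonneg (le_of_lt ht) k) (sq_nonneg _)
      have hnorm : ∫ t in a..1, ‖t ^ (k - 2) * f t ^ 2‖ = ∫ t in a..1, t ^ (k - 2) * f t ^ 2 := by
        refine intervalIntegral.integral_congr fun t ht => ?_
        exact Real.norm_of_nonneg (mul_nonneg (Real.rpow_nonneg (le_of_lt (hsub a ha ha1 ht)) _)
          (sq_nonneg _))
      rw [← intervalIntegral.integral_of_le ha1, hnorm]
      have hga : 0 ≤ a ^ (k - 1) * f a ^ 2 := mul_nonneg (Real.rpow_nonneg ha.le _) (sq_nonneg _)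
      rw [Real.one_rpow, one_mul] at hmono
      have h1 : (k - 1) / 2 * ∫ t in a..1, t ^ (k - 2) * f t ^ 2 ≤ f 1 ^ 2 + 2 / (k - 1) * C := by
        have : 2 / (k - 1) * ∫ t in a..1, t ^ k * deriv f t ^ 2 ≤ 2 / (k - 1) * C :=
          mul_le_mul_of_nonneg_left hC (by positivity)
        linarith
      calc ∫ t in a..1, t ^ (k - 2) * f t ^ 2
          = 2 / (k - 1) * ((k - 1) / 2 * ∫ t in a..1, t ^ (k - 2) * f t ^ 2) := by
            field_simp
        _ ≤ _ := mul_le_mul_of_nonneg_left h1 (by positivity)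
  · refine Integrable.mono' (hf.integrableOn_sq.mono_set (Ioi_subset_Ioi zero_le_one))
      ((hc.mono (Ioi_subset_Ioi zero_le_one)).aestronglyMeasurable measurableSet_Ioi) ?_
    refine (ae_restrict_iff' measurableSet_Ioi).2 (Eventually.of_forall fun t ht => ?_)
    have ht1 : (1 : ℝ) < t := ht
    rw [Real.norm_of_nonneg (mul_nonneg (Real.rpow_nonneg (by linarith) _) (sq_nonneg _))]
    exact mul_le_mul_of_nonneg_right (Real.rpow_le_rpow_of_exponent_le ht1.le (by linarith))
      (sq_nonneg _)

theorem integrableOn_hardy_mul (hk : 1 < k) (hf : memE k f) (hg : memE k g) :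
    IntegrableOn (fun t => t ^ (k - 2) * (f t * g t)) (Ioi 0) :=
  integrableOn_weight_mul (fun _ ht => Real.rpow_nonneg (le_of_lt ht) _) (continuousOn_rpow_Ioi _)
    hf.continuousOn hg.continuousOn (hf.integrableOn_hardy hk) (hg.integrableOn_hardy hk)

/-- `E` is closed under linear combinations. -/
theorem comb (hf : memE k f) (hg : memE k g) (a b : ℝ) : memE k fun t => a * f t + b * g t := by
  have h1 : ContDiffOn ℝ 1 (fun t => a * f t + b * g t) (Ioi 0) :=
    (contDiffOn_const.mul hf.1).add (contDiffOn_const.mul hg.1)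
  refine ⟨h1, ?_⟩
  have hi := ((((hf.integrableOn_deriv_sq.const_mul (a ^ 2)).add
    ((hf.integrableOn_deriv_mul hg).const_mul (2 * a * b))).add
    (hg.integrableOn_deriv_sq.const_mul (b ^ 2))).add (hf.integrableOn_sq.const_mul (a ^ 2))).add
    (((hf.integrableOn_mul hg).const_mul (2 * a * b)).add (hg.integrableOn_sq.const_mul (b ^ 2)))
  refine IntegrableOn.congr_fun hi (fun t ht => ?_) measurableSet_Ioi
  simp only [Pi.add_apply]
  rw [(hf.hasDerivAt_comb hg a b ht).deriv]
  ring

end memE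

end Radial

section Translation

/-- The polarised quadratic form of the linearised radial operator. -/
noncomputable def radForm (k : ℝ) (A f g : ℝ → ℝ) : ℝ :=
  ∫ t in Ioi (0 : ℝ), t ^ k * (deriv f t * deriv g t - A t * (f t * g t))

/-- The Hardy inner product. -/
noncomputable def hardyForm (k : ℝ) (f g : ℝ → ℝ) : ℝ :=
  ∫ t in Ioi (0 : ℝ), t ^ (k - 2) * (f t * g t)

/-- `W` is a nonzero element of `E` solving the equation obtained by differentiating
`-V'' - (k/t) V' = F(V)` with `W = V'` and `A = F'(V)`. -/
structure IsDiffSol (k : ℝ) (A W : ℝ → ℝ) : Prop where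
  one_lt : 1 < k
  cont : ContinuousOn A (Ioi 0)
  bdd : ∃ C, ∀ t > 0, |A t| ≤ C
  mem : memE k W
  eq : ∀ t > 0, HasDerivAt (deriv W) (k / t ^ 2 * W t - k / t * deriv W t - A t * W t) t
  ne : ∃ t > 0, W t ≠ 0

variable {k : ℝ} {A W f g : ℝ → ℝ}

namespace memE

theorem integrableOn_pot_mul (hc : ContinuousOn A (Ioi 0)) (hb : ∃ C, ∀ t > 0, |A t| ≤ C)
    (hf : memE k f) (hg : memE k g) :
    IntegrableOn (fun t => t ^ k * (A t * (f t * g t))) (Ioi 0) := by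
  obtain ⟨C, hC⟩ := hb
  refine Integrable.mono' ((hf.integrableOn_mul hg).norm.const_mul C)
    (((continuousOn_rpow_Ioi k).mul
    (hc.mul (hf.continuousOn.mul hg.continuousOn))).aestronglyMeasurable measurableSet_Ioi) ?_
  refine (ae_restrict_iff' measurableSet_Ioi).2 (Eventually.of_forall fun t ht => ?_)
  rw [mul_left_comm, norm_mul (A t)]
  exact mul_le_mul_of_nonneg_right (hC t ht) (norm_nonneg _)

theorem integrableOn_radForm (hc : ContinuousOn A (Ioi 0)) (hb : ∃ C, ∀ t > 0, |A t| ≤ C)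
    (hf : memE k f) (hg : memE k g) :
    IntegrableOn (fun t => t ^ k * (deriv f t * deriv g t - A t * (f t * g t))) (Ioi 0) := by
  simp only [mul_sub]
  exact (hf.integrableOn_deriv_mul hg).sub (integrableOn_pot_mul hc hb hf hg)

end memE

theorem radForm_comb (hc : ContinuousOn A (Ioi 0)) (hb : ∃ C, ∀ t > 0, |A t| ≤ C)
    (hf : memE k f) (hg : memE k g) (a b : ℝ) :
    radForm k A (fun t => a * f t + b * g t) (fun t => a * f t + b * g t) =
      a ^ 2 * radForm k A f f + 2 * a * b * radForm k A f g + b ^ 2 * radForm k A g g := by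
  have h1 := (memE.integrableOn_radForm hc hb hf hf).const_mul (a ^ 2)
  have h2 := (memE.integrableOn_radForm hc hb hf hg).const_mul (2 * a * b)
  have h3 := (memE.integrableOn_radForm hc hb hg hg).const_mul (b ^ 2)
  have h12 := integral_add (h1.add h2) h3
  simp only [Pi.add_apply] at h12
  simp only [radForm]
  rw [← integral_const_mul, ← integral_const_mul, ← integral_const_mul, ← integral_add h1 h2,
    ← h12]
  refine setIntegral_congr_fun measurableSet_Ioi fun t ht => ?_
  rw [(hf.hasDerivAt_comb hg a b ht).deriv]
  ring

theorem hardyForm_comb (hk : 1 < k) (hf : memE k f) (hg : memE k g) (a b : ℝ) :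
    hardyForm k (fun t => a * f t + b * g t) (fun t => a * f t + b * g t) =
      a ^ 2 * hardyForm k f f + 2 * a * b * hardyForm k f g + b ^ 2 * hardyForm k g g := by
  have h1 := (hf.integrableOn_hardy_mul hk hf).const_mul (a ^ 2)
  have h2 := (hf.integrableOn_hardy_mul hk hg).const_mul (2 * a * b)
  have h3 := (hg.integrableOn_hardy_mul hk hg).const_mul (b ^ 2)
  have h12 := integral_add (h1.add h2) h3
  simp only [Pi.add_apply] at h12
  simp only [hardyForm]
  rw [← integral_const_mul, ← integral_const_mul, ← integral_const_mul, ← integral_add h1 h2,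
    ← h12]
  refine setIntegral_congr_fun measurableSet_Ioi fun t ht => ?_
  ring

theorem hardyForm_self_nonneg (k : ℝ) (f : ℝ → ℝ) : 0 ≤ hardyForm k f f :=
  setIntegral_nonneg measurableSet_Ioi fun _ ht =>
    mul_nonneg (Real.rpow_nonneg (le_of_lt ht) _) (mul_self_nonneg _)

theorem setIntegral_weight_pos {s : ℝ} (hf : ContinuousOn f (Ioi 0))
    (hi : IntegrableOn (fun t => t ^ s * (f t * f t)) (Ioi 0)) (hne : ∃ t > 0, f t ≠ 0) :
    0 < ∫ t in Ioi (0 : ℝ), t ^ s * (f t * f t) := by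
  obtain ⟨t₀, ht₀, hft⟩ := hne
  have hpos : ∀ t ∈ Ioi (0 : ℝ), 0 ≤ t ^ s * (f t * f t) := fun t ht =>
    mul_nonneg (Real.rpow_nonneg (le_of_lt ht) _) (mul_self_nonneg _)
  rw [setIntegral_pos_iff_support_of_nonneg_ae
    ((ae_restrict_iff' measurableSet_Ioi).2 (Eventually.of_forall hpos)) hi]
  have hopen : IsOpen (Ioi (0 : ℝ) ∩ f ⁻¹' {0}ᶜ) :=
    hf.isOpen_inter_preimage isOpen_Ioi isOpen_compl_singleton
  refine lt_of_lt_of_le (hopen.measure_pos volume ⟨t₀, ht₀, hft⟩) (measure_mono ?_)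
  rintro t ⟨ht, hft⟩
  have h0 : f t ≠ 0 := hft
  have := Real.rpow_pos_of_pos (mem_Ioi.1 ht) s
  exact ⟨mul_ne_zero this.ne' (mul_ne_zero h0 h0), ht⟩

namespace IsDiffSol

theorem hardyForm_pos (h : IsDiffSol k A W) : 0 < hardyForm k W W :=
  setIntegral_weight_pos h.mem.continuousOn (h.mem.integrableOn_hardy_mul h.one_lt h.mem) h.ne

theorem radForm_eq (h : IsDiffSol k A W) (hf : memE k f) :
    radForm k A W f = -k * hardyForm k W f := by
  have hk := h.one_lt
  have i1 := (h.mem.integrableOn_hardy_mul hk hf).const_mul k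
  have i2 := h.mem.integrableOn_radForm h.cont h.bdd hf
  have key := integral_eq_zero_of_integrableOn_div
    (f := fun t => t ^ k * (deriv W t * f t))
    (f' := fun t => k * (t ^ (k - 2) * (W t * f t)) +
      t ^ k * (deriv W t * deriv f t - A t * (W t * f t))) (fun t ht => ?_) (i1.add i2) ?_
  · rw [integral_add i1 i2, integral_const_mul] at key
    rw [radForm, hardyForm]
    linarith
  · have ht0 : t ≠ 0 := ne_of_gt ht
    refine ((Real.hasDerivAt_rpow_const (p := k) (Or.inl ht0)).mul
      ((h.eq t ht).mul (hf.hasDerivAt ht))).congr_deriv ?_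
    have e1 : t ^ (k - 1) = t * t ^ (k - 2) := by
      rw [show k - 1 = k - 2 + 1 by ring, Real.rpow_add_one ht0, mul_comm]
    have e2 : t ^ k = t ^ 2 * t ^ (k - 2) := by
      rw [show t ^ k = t ^ (k - 2 + (2 : ℕ)) by push_cast; ring_nf, Real.rpow_add_natCast ht0,
        mul_comm]
    rw [e1, e2, Pi.mul_apply]
    field_simp
    ring
  · refine Integrable.mono' (h.mem.integrableOn_deriv_sq.add (hf.integrableOn_hardy hk))
      (((continuousOn_inv₀.mono fun t ht => ne_of_gt ht).mul ((continuousOn_rpow_Ioi _).mul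
        (h.mem.continuousOn_deriv.mul hf.continuousOn))).aestronglyMeasurable measurableSet_Ioi) ?_
    refine (ae_restrict_iff' measurableSet_Ioi).2 (Eventually.of_forall fun t ht => ?_)
    have ht0 : 0 < t := ht
    have e2 : t ^ k = t ^ 2 * t ^ (k - 2) := by
      rw [show t ^ k = t ^ (k - 2 + (2 : ℕ)) by push_cast; ring_nf, Real.rpow_add_natCast ht0.ne',
        mul_comm]
    have hp := Real.rpow_pos_of_pos ht0 (k - 2)
    rw [Pi.add_apply, e2, Real.norm_eq_abs,
      show t⁻¹ * (t ^ 2 * t ^ (k - 2) * (deriv W t * f t)) =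
        t ^ (k - 2) * ((t * deriv W t) * f t) by field_simp,
      show t ^ 2 * t ^ (k - 2) * deriv W t ^ 2 + t ^ (k - 2) * f t ^ 2 =
        t ^ (k - 2) * ((t * deriv W t) ^ 2 + f t ^ 2) by ring, abs_mul, abs_of_pos hp]
    refine mul_le_mul_of_nonneg_left ?_ hp.le
    rw [abs_le]
    constructor <;> nlinarith [sq_nonneg (t * deriv W t + f t), sq_nonneg (t * deriv W t - f t),
      sq_nonneg (t * deriv W t), sq_nonneg (f t)]

/-- Consequence of the Morse index one property. -/
theorem radForm_add_nonneg (h : IsDiffSol k A W) (hm : MorseIndexOne k A) (hf : memE k f) {κ : ℝ}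
    (hκ : 0 ≤ κ) (hor : k ≤ κ ∨ hardyForm k W f = 0) :
    0 ≤ radForm k A f f + κ * hardyForm k f f := by
  by_contra! hneg
  have hk := h.one_lt
  have hpos := h.hardyForm_pos
  have hff := hardyForm_self_nonneg k f
  have hlt : ∀ a b : ℝ, ¬(a = 0 ∧ b = 0) →
      radForm k A (fun t => a * W t + b * f t) (fun t => a * W t + b * f t) < 0 := by
    intro a b hab
    rw [radForm_comb h.cont h.bdd h.mem hf, h.radForm_eq h.mem, h.radForm_eq hf]
    have hb0 : b ^ 2 * (radForm k A f f + κ * hardyForm k f f) ≤ 0 :=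
      mul_nonpos_of_nonneg_of_nonpos (sq_nonneg _) hneg.le
    by_cases hb : b = 0
    · subst hb
      have ha : a ≠ 0 := fun ha => hab ⟨ha, rfl⟩
      have : 0 < k * (a ^ 2 * hardyForm k W W) := by positivity
      nlinarith
    · have hb' : b ^ 2 * (radForm k A f f + κ * hardyForm k f f) < 0 :=
        mul_neg_of_pos_of_neg (by positivity) hneg
      rcases hor with hκk | h0
      · have h1 : 0 ≤ hardyForm k (fun t => a * W t + b * f t) (fun t => a * W t + b * f t) :=
          hardyForm_self_nonneg _ _
        rw [hardyForm_comb hk h.mem hf] at h1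
        have h2 : 0 ≤ (κ - k) * (b ^ 2 * hardyForm k f f) :=
          mul_nonneg (by linarith) (by positivity)
        nlinarith
      · rw [h0]
        have h1 : 0 ≤ k * (a ^ 2 * hardyForm k W W) := by positivity
        have h2 : 0 ≤ κ * (b ^ 2 * hardyForm k f f) := by positivity
        nlinarith
  obtain ⟨a, b, hab, hR⟩ := hm.2 W f h.mem hf fun a b h0 => by
    by_contra hab
    refine absurd (hlt a b hab) (not_lt.2 (le_of_eq ?_))
    refine (integral_eq_zero_of_ae ?_).symm
    refine (ae_restrict_iff' measurableSet_Ioi).2 (Eventually.of_forall fun t ht => ?_)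
    have hd : deriv (fun t => a * W t + b * f t) t = 0 := by
      have : (fun t => a * W t + b * f t) =ᶠ[𝓝 t] fun _ => 0 :=
        Filter.eventuallyEq_of_mem (Ioi_mem_nhds ht) h0
      rw [this.deriv_eq, deriv_const]
    simp only [hd, h0 t ht]
    simp
  have hnum := hlt a b hab
  have hw := h.mem.comb hf a b
  have hne : ∃ t > 0, a * W t + b * f t ≠ 0 := by
    by_contra! h0
    refine absurd hnum (not_lt.2 (le_of_eq (integral_eq_zero_of_ae ?_).symm))
    refine (ae_restrict_iff' measurableSet_Ioi).2 (Eventually.of_forall fun t ht => ?_)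
    have hd : deriv (fun t => a * W t + b * f t) t = 0 := by
      have : (fun t => a * W t + b * f t) =ᶠ[𝓝 t] fun _ => 0 :=
        Filter.eventuallyEq_of_mem (Ioi_mem_nhds ht) h0
      rw [this.deriv_eq, deriv_const]
    simp only [hd, h0 t ht]
    simp
  have hden := setIntegral_weight_pos hw.continuousOn (hw.integrableOn_mul hw) hne
  have hRn : Ray k A (fun t => a * W t + b * f t) < 0 := by
    rw [Ray]
    refine div_neg_of_neg_of_pos ?_ ?_
    · simpa only [radForm, pow_two] using hnum
    · simpa only [pow_two] using hden
  exact absurd hR (not_le.2 hRn)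

end IsDiffSol

end Translation

section Profile

theorem isCompact_range_of_tendsto {V : ℝ → ℝ} (hV : DifferentiableOn ℝ V (Ioi 0))
    (hV'0 : Tendsto (deriv V) (𝓝[>] 0) (𝓝 0)) (hVinf : Tendsto V atTop (𝓝 0)) :
    ∃ C, ∀ t > 0, V t ∈ Icc (-C) C := by
  have hd : ∀ t > 0, HasDerivAt V (deriv V t) t := fun t ht =>
    ((hV t ht).differentiableAt (Ioi_mem_nhds ht)).hasDerivAt
  obtain ⟨δ, hδ, h1⟩ : ∃ δ > 0, ∀ t, 0 < t → t < δ → ‖deriv V t‖ ≤ 1 := by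
    have h := hV'0.norm.eventually_lt_const (u := 1) (by simp)
    rw [eventually_nhdsWithin_iff, Metric.eventually_nhds_iff] at h
    obtain ⟨δ, hδ, h⟩ := h
    refine ⟨δ, hδ, fun t ht htδ => (h ?_ ht).le⟩
    rwa [Real.dist_eq, sub_zero, abs_of_pos ht]
  obtain ⟨T, h2⟩ : ∃ T, ∀ t ≥ T, ‖V t‖ ≤ 1 := by
    have h := hVinf.norm.eventually_lt_const (u := 1) (by simp)
    obtain ⟨T, hT⟩ := eventually_atTop.1 h
    exact ⟨T, fun t ht => (hT t ht).le⟩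
  obtain ⟨C, h3⟩ := (isCompact_Icc (a := δ / 2) (b := T)).exists_bound_of_continuousOn
    (hV.continuousOn.mono fun t ht => lt_of_lt_of_le (half_pos hδ) ht.1)
  refine ⟨max (max 1 C) (‖V (δ / 2)‖ + δ), fun t ht => abs_le.1 ?_⟩
  rcases lt_or_ge t (δ / 2) with h | h
  · have hm := (convex_Ioo 0 δ).norm_image_sub_le_of_norm_deriv_le (f := V) (C := 1)
      (fun x hx => (hd x hx.1).differentiableAt) (fun x hx => h1 x hx.1 hx.2)
      (⟨half_pos hδ, half_lt_self hδ⟩ : δ / 2 ∈ Ioo 0 δ) (⟨ht, by linarith⟩ : t ∈ Ioo 0 δ)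
    refine le_trans ?_ (le_max_right _ _)
    have h4 := norm_sub_norm_le (V t) (V (δ / 2))
    have h5 : ‖t - δ / 2‖ ≤ δ := by
      rw [Real.norm_eq_abs, abs_le]
      constructor <;> linarith
    rw [← Real.norm_eq_abs]
    linarith
  · refine le_trans ?_ (le_max_left _ _)
    rcases le_total t T with h' | h'
    · exact (h3 t ⟨h, h'⟩).trans (le_max_right _ _)
    · exact (h2 t h').trans (le_max_left _ _)

theorem isDiffSol_deriv {k : ℝ} (hk : 1 < k) {F V : ℝ → ℝ} (hF : ContDiff ℝ 1 F)
    (hV : ContDiffOn ℝ 2 V (Ioi 0)) (hVpos : ∀ t > (0 : ℝ), 0 < V t)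
    (hode : ∀ t > (0 : ℝ), -(deriv (deriv V) t) - k / t * deriv V t = F (V t))
    (hV'0 : Tendsto (deriv V) (𝓝[>] 0) (𝓝 0)) (hVinf : Tendsto V atTop (𝓝 0))
    (hV'E : memE k (deriv V)) : IsDiffSol k (fun t => deriv F (V t)) (deriv V) := by
  have hdV : DifferentiableOn ℝ V (Ioi 0) := hV.differentiableOn two_ne_zero
  have hd : ∀ t > 0, HasDerivAt V (deriv V t) t := fun t ht =>
    ((hdV t ht).differentiableAt (Ioi_mem_nhds ht)).hasDerivAt
  have hF' : Continuous (deriv F) := hF.continuous_deriv le_rfl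
  refine ⟨hk, hF'.comp_continuousOn hV.continuousOn, ?_, hV'E, fun t ht => ?_, ?_⟩
  · obtain ⟨C, hC⟩ := isCompact_range_of_tendsto hdV hV'0 hVinf
    obtain ⟨C', hC'⟩ := (isCompact_Icc (a := -C) (b := C)).exists_bound_of_continuousOn
      hF'.continuousOn
    exact ⟨C', fun t ht => hC' _ (hC t ht)⟩
  · have hev : deriv (deriv V) =ᶠ[𝓝 t] fun s => -(F (V s)) - k / s * deriv V s := by
      filter_upwards [Ioi_mem_nhds ht] with s hs
      have := hode s hs
      linarith
    refine HasDerivAt.congr_of_eventuallyEq ?_ hev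
    have hFd : HasDerivAt F (deriv F (V t)) (V t) :=
      (hF.differentiable one_ne_zero _).hasDerivAt
    have h1 := (hFd.comp t (hd t ht)).neg.sub
      (((hasDerivAt_const t k).div (hasDerivAt_id t) (ne_of_gt ht)).mul (hV'E.hasDerivAt ht))
    refine h1.congr_deriv ?_
    have ht0 : t ≠ 0 := ne_of_gt ht
    simp only [id, Pi.div_apply]
    field_simp
    ring
  · by_contra! h0
    have hconst : ∀ t > 0, V t = V 1 := fun t ht =>
      (convex_Ioi 0).is_const_of_fderivWithin_eq_zero hdV (fun x hx => by
        rw [fderivWithin_of_isOpen isOpen_Ioi hx]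
        ext
        simpa using h0 x hx) ht (mem_Ioi.2 one_pos)
    have hlim : Tendsto V atTop (𝓝 (V 1)) :=
      tendsto_const_nhds.congr' ((eventually_gt_atTop 0).mono fun t ht => (hconst t ht).symm)
    exact (hVpos 1 one_pos).ne' (tendsto_nhds_unique hlim hVinf)

end Profile

section Slices

variable {N : ℕ} {β : ℝ} {w : EuclideanSpace ℝ (Fin N) → ℝ}

/-- The function `w` on the sphere of radius `polRad β t`, rescaled to the unit sphere. -/
noncomputable def polSlice (β : ℝ) (w : EuclideanSpace ℝ (Fin N) → ℝ) (t : ℝ)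
    (x : EuclideanSpace ℝ (Fin N)) : ℝ :=
  w (polRad β t • x)

/-- The derivative of `polSlice β w t` in `t`. -/
noncomputable def polSliceDeriv (β : ℝ) (w : EuclideanSpace ℝ (Fin N) → ℝ) (t : ℝ)
    (x : EuclideanSpace ℝ (Fin N)) : ℝ :=
  fderiv ℝ w (polRad β t • x) ((β * t) ^ (1 / β - 1) • x)

theorem continuousOn_polRad (hβ : 0 < β) : ContinuousOn (polRad β) (Ioi 0) := fun _ ht =>
  (hasDerivAt_polRad hβ ht).continuousAt.continuousWithinAt

theorem contDiffOn_comp_smul (hw : ContDiffOn ℝ 1 w {x | x ≠ 0}) {r : ℝ} (hr : r ≠ 0) :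
    ContDiffOn ℝ 1 (fun x => w (r • x)) {x | x ≠ 0} :=
  hw.comp (contDiff_const_smul r).contDiffOn fun _ hx => smul_ne_zero hr hx

theorem angDeriv_comp_smul (hw : ContDiffOn ℝ 1 w {x | x ≠ 0}) {r : ℝ} (hr : r ≠ 0) (a b : Fin N)
    {x : EuclideanSpace ℝ (Fin N)} (hx : x ≠ 0) :
    angDeriv a b (fun y => w (r • y)) x = angDeriv a b w (r • x) := by
  have h := (hw.differentiableAt_ne_zero (smul_ne_zero hr hx)).hasFDerivAt.comp x
    ((hasFDerivAt_id x).const_smul r)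
  have e : fderiv ℝ (fun y => w (r • y)) x = _ := h.fderiv
  rw [angDeriv, e, angDeriv, map_smul (rotField a b)]
  rfl

theorem contDiffOn_polSlice (hβ : 0 < β) (hw : ContDiffOn ℝ 1 w {x | x ≠ 0}) {t : ℝ} (ht : 0 < t) :
    ContDiffOn ℝ 1 (polSlice β w t) {x | x ≠ 0} :=
  contDiffOn_comp_smul hw (polRad_pos hβ ht).ne'

theorem sphDir_polSlice (hβ : 0 < β) (hw : ContDiffOn ℝ 1 w {x | x ≠ 0}) {t : ℝ} (ht : 0 < t) :
    sphDir (polSlice β w t) (polSlice β w t) = ∫ θ, polAng β w (t, θ) ∂sphMeas N := by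
  have e : ∀ a b (θ : Sph N), angDeriv a b (polSlice β w t) θ = angDeriv a b w (polMap β (t, θ)) :=
    fun a b θ => angDeriv_comp_smul hw (polRad_pos hβ ht).ne' a b θ.ne_zero
  have hc : ∀ a b, Continuous fun θ : Sph N => angDeriv a b w (polMap β (t, θ)) ^ 2 := fun a b => by
    simp only [← e]
    exact (continuous_sph (continuousOn_angDeriv (contDiffOn_polSlice hβ hw ht) a b)).pow 2
  simp only [sphDir, polAng, integral_const_mul]
  congr 1
  rw [integral_finsetSum _ fun a _ => integrable_finsetSum _ fun b _ => integrable_sphMeas (hc a b)]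
  refine Finset.sum_congr rfl fun a _ => ?_
  rw [integral_finsetSum _ fun b _ => integrable_sphMeas (hc a b)]
  exact Finset.sum_congr rfl fun b _ => integral_congr_ae (Eventually.of_forall fun θ => by
    simp only [e, sq])

theorem continuous_polSlice (hβ : 0 < β) (hw : ContDiffOn ℝ 1 w {x | x ≠ 0}) :
    Continuous fun p : Ioi (0 : ℝ) × Sph N => polSlice β w p.1 p.2 := by
  refine hw.continuousOn.comp_continuous ?_ fun p =>
    smul_ne_zero (polRad_pos hβ p.1.2).ne' p.2.ne_zero
  exact ((continuousOn_iff_continuous_domRestrict.1 (continuousOn_polRad hβ)).comp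
    continuous_fst).smul (continuous_subtype_val.comp continuous_snd)

theorem continuous_polSliceDeriv (hβ : 0 < β) (hw : ContDiffOn ℝ 1 w {x | x ≠ 0}) :
    Continuous fun p : Ioi (0 : ℝ) × Sph N => polSliceDeriv β w p.1 p.2 := by
  refine Continuous.clm_apply ?_ ?_
  · refine (hw.continuousOn_fderiv_of_isOpen isOpen_ne le_rfl).comp_continuous ?_ fun p =>
      smul_ne_zero (polRad_pos hβ p.1.2).ne' p.2.ne_zero
    exact ((continuousOn_iff_continuous_domRestrict.1 (continuousOn_polRad hβ)).comp
      continuous_fst).smul (continuous_subtype_val.comp continuous_snd)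
  · refine Continuous.smul (Continuous.rpow_const (by fun_prop) fun p => Or.inl ?_) (by fun_prop)
    exact (mul_pos hβ p.1.2).ne'

theorem continuous_polSlice_sph (hβ : 0 < β) (hw : ContDiffOn ℝ 1 w {x | x ≠ 0}) {t : ℝ}
    (ht : 0 < t) : Continuous fun θ : Sph N => polSlice β w t θ :=
  (continuous_polSlice hβ hw).comp (Continuous.prodMk_right (⟨t, ht⟩ : Ioi (0 : ℝ)))

theorem continuous_polSliceDeriv_sph (hβ : 0 < β) (hw : ContDiffOn ℝ 1 w {x | x ≠ 0}) {t : ℝ}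
    (ht : 0 < t) : Continuous fun θ : Sph N => polSliceDeriv β w t θ :=
  (continuous_polSliceDeriv hβ hw).comp (Continuous.prodMk_right (⟨t, ht⟩ : Ioi (0 : ℝ)))

theorem hasDerivAt_polSlice (hβ : 0 < β) (hw : ContDiffOn ℝ 1 w {x | x ≠ 0}) {t : ℝ} (ht : 0 < t)
    {x : EuclideanSpace ℝ (Fin N)} (hx : x ≠ 0) :
    HasDerivAt (fun t => polSlice β w t x) (polSliceDeriv β w t x) t := by
  have h1 := (hasDerivAt_polRad hβ ht).smul_const x
  exact (hw.differentiableAt_ne_zero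
    (smul_ne_zero (polRad_pos hβ ht).ne' hx)).hasFDerivAt.comp_hasDerivAt t h1

theorem hasDerivAt_sphCoef_polSlice (hβ : 0 < β) (hw : ContDiffOn ℝ 1 w {x | x ≠ 0}) {t : ℝ}
    (ht : 0 < t) (p : MvPolynomial (Fin N) ℝ) :
    HasDerivAt (fun t => sphCoef (polSlice β w t) p) (sphCoef (polSliceDeriv β w t) p) t := by
  have hK : IsCompact ((univ : Set (Icc (t / 2) (2 * t) × Sph N))) := isCompact_univ
  let ι : Icc (t / 2) (2 * t) × Sph N → Ioi (0 : ℝ) × Sph N := fun q =>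
    (⟨q.1, lt_of_lt_of_le (half_pos ht) q.1.2.1⟩, q.2)
  have hι : Continuous ι := by fun_prop
  obtain ⟨C, hC⟩ := hK.exists_bound_of_continuousOn
    (((continuous_polSliceDeriv hβ hw).comp hι).mul
      ((continuous_polyFun_sph p).comp continuous_snd)).continuousOn
  have hnhds : Icc (t / 2) (2 * t) ∈ 𝓝 t := Icc_mem_nhds (by linarith) (by linarith)
  refine (hasDerivAt_integral_of_dominated_loc_of_deriv_le (μ := sphMeas N) (x₀ := t)
    (F := fun t (θ : Sph N) => polSlice β w t θ * polyFun p θ)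
    (F' := fun t (θ : Sph N) => polSliceDeriv β w t θ * polyFun p θ) (bound := fun _ => C) hnhds
    ?_ ?_ ?_ ?_ (integrable_sphMeas continuous_const) ?_).2
  · filter_upwards [Ioi_mem_nhds ht] with s hs
    exact ((continuous_polSlice_sph hβ hw hs).mul (continuous_polyFun_sph p)).aestronglyMeasurable
  · exact integrable_sphMeas ((continuous_polSlice_sph hβ hw ht).mul (continuous_polyFun_sph p))
  · exact ((continuous_polSliceDeriv_sph hβ hw ht).mul
      (continuous_polyFun_sph p)).aestronglyMeasurable
  · exact Eventually.of_forall fun θ s hs => hC (⟨s, hs⟩, θ) (mem_univ _)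
  · exact Eventually.of_forall fun θ s hs => (hasDerivAt_polSlice hβ hw
      (lt_of_lt_of_le (half_pos ht) hs.1) θ.ne_zero).mul_const _

theorem continuousOn_sphCoef_polSliceDeriv (hβ : 0 < β) (hw : ContDiffOn ℝ 1 w {x | x ≠ 0})
    (p : MvPolynomial (Fin N) ℝ) :
    ContinuousOn (fun t => sphCoef (polSliceDeriv β w t) p) (Ioi 0) := by
  rw [continuousOn_iff_continuous_domRestrict]
  have : LocallyCompactSpace (Ioi (0 : ℝ)) := isOpen_Ioi.locallyCompactSpace
  have h := continuous_parametric_integral_of_continuous (μ := sphMeas N)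
    (f := fun (t : Ioi (0 : ℝ)) (θ : Sph N) => polSliceDeriv β w t θ * polyFun p θ)
    ((continuous_polSliceDeriv hβ hw).mul ((continuous_polyFun_sph p).comp continuous_snd))
    isCompact_univ
  simp only [Measure.restrict_univ] at h
  exact h

theorem contDiffOn_sphCoef_polSlice (hβ : 0 < β) (hw : ContDiffOn ℝ 1 w {x | x ≠ 0})
    (p : MvPolynomial (Fin N) ℝ) :
    ContDiffOn ℝ 1 (fun t => sphCoef (polSlice β w t) p) (Ioi 0) := by
  refine (contDiffOn_one_iff_derivWithin isOpen_Ioi.uniqueDiffOn).2 ⟨fun t ht =>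
    (hasDerivAt_sphCoef_polSlice hβ hw ht p).differentiableAt.differentiableWithinAt, ?_⟩
  refine (continuousOn_sphCoef_polSliceDeriv hβ hw p).congr fun t ht => ?_
  rw [derivWithin_of_isOpen isOpen_Ioi ht, (hasDerivAt_sphCoef_polSlice hβ hw ht p).deriv]

theorem deriv_sphCoef_polSlice (hβ : 0 < β) (hw : ContDiffOn ℝ 1 w {x | x ≠ 0})
    (p : MvPolynomial (Fin N) ℝ) {t : ℝ} (ht : 0 < t) :
    deriv (fun t => sphCoef (polSlice β w t) p) t = sphCoef (polSliceDeriv β w t) p :=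
  (hasDerivAt_sphCoef_polSlice hβ hw ht p).deriv

theorem sphCoef_sq_le {ι : Type*} [Fintype ι] [DecidableEq ι] {M : ℕ}
    {Y : ι → MvPolynomial (Fin N) ℝ} {μ : ι → ℝ} (hY : IsSphBasis M Y μ)
    {f : EuclideanSpace ℝ (Fin N) → ℝ} (hf : Continuous fun θ : Sph N => f θ) (i : ι) :
    sphCoef f (Y i) ^ 2 ≤ ∫ θ : Sph N, f θ ^ 2 ∂sphMeas N := by
  have h := hY.sphRem_nonneg hf
  rw [sphRem] at h
  have := Finset.single_le_sum (f := fun i => sphCoef f (Y i) ^ 2) (fun _ _ => sq_nonneg _)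
    (Finset.mem_univ i)
  linarith

variable {α : ℝ}

theorem integrable_polMeas_pieces [NeZero N] (hα : 0 < α) (hw : Dmem N α w) :
    Integrable (fun z : ℝ × Sph N => z.1 ^ kk N α * polSlice (1 + α / 2) w z.1 z.2 ^ 2)
      (polMeas N) ∧
    Integrable (fun z : ℝ × Sph N => z.1 ^ kk N α * polSliceDeriv (1 + α / 2) w z.1 z.2 ^ 2)
      (polMeas N) ∧
    Integrable (fun z : ℝ × Sph N => z.1 ^ kk N α * (1 / ((1 + α / 2) * z.1) ^ 2 *
      polAng (1 + α / 2) w z)) (polMeas N) := by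
  obtain ⟨h1, h2⟩ := (dmem_iff_polar hα hw.1).1 hw
  have hβ : 0 < 1 + α / 2 := by positivity
  have hm : AEStronglyMeasurable (fun z : ℝ × Sph N =>
      z.1 ^ kk N α * polSliceDeriv (1 + α / 2) w z.1 z.2 ^ 2) (polMeas N) := by
    have hc : ContinuousOn (fun z : ℝ × Sph N =>
        z.1 ^ kk N α * polSliceDeriv (1 + α / 2) w z.1 z.2 ^ 2) (Ioi 0 ×ˢ univ) := by
      refine ContinuousOn.mul (continuous_fst.continuousOn.rpow_const fun z hz =>
        Or.inl (ne_of_gt hz.1)) (ContinuousOn.pow ?_ 2)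
      rw [continuousOn_iff_continuous_domRestrict]
      exact (continuous_polSliceDeriv hβ hw.1).comp
        (f := fun z : (Ioi (0 : ℝ) ×ˢ (univ : Set (Sph N)) :
        Set (ℝ × Sph N)) => ((⟨z.1.1, z.2.1⟩, z.1.2) : Ioi (0 : ℝ) × Sph N)) (by fun_prop)
    have h := hc.aestronglyMeasurable (μ := (volume : Measure ℝ).prod (sphMeas N))
      (measurableSet_Ioi.prod MeasurableSet.univ)
    rwa [← Measure.prod_restrict, Measure.restrict_univ] at h
  have hD : Integrable (fun z : ℝ × Sph N =>
      z.1 ^ kk N α * polSliceDeriv (1 + α / 2) w z.1 z.2 ^ 2) (polMeas N) := by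
    refine Integrable.mono' h2 hm ?_
    filter_upwards [ae_polMeas] with z hz
    have hp := Real.rpow_nonneg hz.le (kk N α)
    rw [Real.norm_of_nonneg (mul_nonneg hp (sq_nonneg _))]
    exact mul_le_mul_of_nonneg_left (le_add_of_nonneg_right
      (mul_nonneg (by positivity) (polAng_nonneg _ _ _))) hp
  refine ⟨h1, hD, (h2.sub hD).congr (Eventually.of_forall fun z => ?_)⟩
  simp only [Pi.sub_apply, polDt, polSliceDeriv, polMap]
  ring

theorem memE_sphCoef_polSlice [NeZero N] (hα : 0 < α) (hw : Dmem N α w)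
    {ι : Type*} [Fintype ι] [DecidableEq ι] {M : ℕ}
    {Y : ι → MvPolynomial (Fin N) ℝ} {μ : ι → ℝ} (hY : IsSphBasis M Y μ) (i : ι) :
    memE (kk N α) fun t => sphCoef (polSlice (1 + α / 2) w t) (Y i) := by
  have hβ : 0 < 1 + α / 2 := by positivity
  have hC := contDiffOn_sphCoef_polSlice hβ hw.1 (Y i)
  obtain ⟨h1, h2, -⟩ := integrable_polMeas_pieces hα hw
  refine ⟨hC, Integrable.mono' (h2.integral_prod_left.add h1.integral_prod_left) ?_ ?_⟩
  · exact ((continuousOn_rpow_Ioi _).mul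
      (((hC.continuousOn_deriv_of_isOpen isOpen_Ioi le_rfl).pow 2).add
        (hC.continuousOn.pow 2))).aestronglyMeasurable measurableSet_Ioi
  · refine (ae_restrict_iff' measurableSet_Ioi).2 (Eventually.of_forall fun t ht => ?_)
    have hp := Real.rpow_nonneg (le_of_lt (mem_Ioi.1 ht)) (kk N α)
    rw [Real.norm_of_nonneg (by positivity), deriv_sphCoef_polSlice hβ hw.1 _ ht, Pi.add_apply]
    simp only [integral_const_mul]
    rw [← mul_add]
    exact mul_le_mul_of_nonneg_left (add_le_add
      (sphCoef_sq_le hY (continuous_polSliceDeriv_sph hβ hw.1 ht) i)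
      (sphCoef_sq_le hY (continuous_polSlice_sph hβ hw.1 ht) i)) hp

end Slices

section Decomposition

variable {N : ℕ} {α : ℝ} {A W : ℝ → ℝ} {w : EuclideanSpace ℝ (Fin N) → ℝ}

theorem kk_mul_sq (hα : 0 < α) :
    kk N α * (1 + α / 2) ^ 2 = (1 + α / 2) * ((1 + α / 2) + N - 2) := by
  rw [kk]
  field_simp
  ring

theorem one_lt_kk (hN : 3 ≤ N) (hα : 0 < α) : 1 < kk N α := by
  have : (3 : ℝ) ≤ N := by exact_mod_cast hN
  rw [kk, one_lt_div (by positivity)]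
  linarith

theorem sphEig_nonneg (hN : 3 ≤ N) (j : ℕ) : 0 ≤ sphEig N j := by
  have h3 : (3 : ℝ) ≤ N := by exact_mod_cast hN
  have hj : (0 : ℝ) ≤ j := j.cast_nonneg
  exact mul_nonneg hj (by linarith)

theorem kk_le_sphEig_div (hN : 3 ≤ N) (hα : 0 < α) {j : ℕ} (hj : 1 + α / 2 ≤ j) :
    kk N α ≤ sphEig N j / (1 + α / 2) ^ 2 := by
  have h3 : (3 : ℝ) ≤ N := by exact_mod_cast hN
  rw [le_div_iff₀ (by positivity), kk_mul_sq hα, sphEig]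
  exact mul_le_mul hj (by linarith) (by linarith) (by linarith)

theorem sphEig_div_lt_kk (hN : 3 ≤ N) (hα : 0 < α) {j : ℕ} (hj : (j : ℝ) < 1 + α / 2) :
    sphEig N j / (1 + α / 2) ^ 2 < kk N α := by
  have h3 : (3 : ℝ) ≤ N := by exact_mod_cast hN
  have hj0 : (0 : ℝ) ≤ j := j.cast_nonneg
  rw [div_lt_iff₀ (by positivity), kk_mul_sq hα, sphEig]
  exact mul_lt_mul'' hj (by linarith) hj0 (by linarith)

variable {ι ι₀ : Type*} [Fintype ι] [DecidableEq ι] [Fintype ι₀] [DecidableEq ι₀] {M M₀ : ℕ}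
  {Y : ι → MvPolynomial (Fin N) ℝ} {μ : ι → ℝ} {Y₀ : ι₀ → MvPolynomial (Fin N) ℝ} {μ₀ : ι₀ → ℝ}

theorem radForm_sphCoef_nonneg [NeZero N] (hN : 3 ≤ N) (hα : 0 < α) (h : IsDiffSol (kk N α) A W)
    (hm : MorseIndexOne (kk N α) A) (hw : Dmem N α w) (hM₀ : 1 + α / 2 ≤ M₀ + 2)
    (hY₀ : IsSphBasis M₀ Y₀ μ₀)
    (horth : ∀ i, hardyForm (kk N α) W
      (fun t => sphCoef (polSlice (1 + α / 2) w t) (Y₀ i)) = 0)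
    (hY : IsSphBasis M Y μ) (i : ι) :
    0 ≤ radForm (kk N α) A (fun t => sphCoef (polSlice (1 + α / 2) w t) (Y i))
          (fun t => sphCoef (polSlice (1 + α / 2) w t) (Y i)) +
        μ i / (1 + α / 2) ^ 2 * hardyForm (kk N α)
          (fun t => sphCoef (polSlice (1 + α / 2) w t) (Y i))
          (fun t => sphCoef (polSlice (1 + α / 2) w t) (Y i)) := by
  have hβ : 0 < 1 + α / 2 := by positivity
  obtain ⟨j, q, -, hq, hμ, hYq⟩ := hY.degree i
  refine h.radForm_add_nonneg hm (memE_sphCoef_polSlice hα hw hY i) ?_ ?_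
  · rw [hμ]
    exact div_nonneg (sphEig_nonneg hN j) (sq_nonneg _)
  · rcases le_or_gt (M₀ + 2) j with hj | hj
    · left
      rw [hμ]
      refine kk_le_sphEig_div hN hα (hM₀.trans ?_)
      exact_mod_cast hj
    · right
      obtain ⟨c, hc⟩ := hY₀.span q (hq.trans (by omega))
      have e : ∀ t ∈ Ioi (0 : ℝ), t ^ (kk N α - 2) *
          (W t * sphCoef (polSlice (1 + α / 2) w t) (Y i)) =
          ∑ l, c l * (t ^ (kk N α - 2) *
            (W t * sphCoef (polSlice (1 + α / 2) w t) (Y₀ l))) := fun t ht => by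
        have h1 := integral_mul_sum (Y := Y₀) c (continuous_polSlice_sph hβ hw.1 ht)
        simp only [← hc, ← hYq] at h1
        rw [sphCoef, h1, Finset.mul_sum, Finset.mul_sum]
        exact Finset.sum_congr rfl fun l _ => by ring
      rw [hardyForm, setIntegral_congr_fun measurableSet_Ioi e, integral_finsetSum]
      · refine Finset.sum_eq_zero fun l _ => ?_
        rw [integral_const_mul]
        exact mul_eq_zero_of_right _ (horth l)
      · exact fun l _ => (h.mem.integrableOn_hardy_mul h.one_lt
          (memE_sphCoef_polSlice hα hw hY₀ l)).const_mul _

/-- The energy of `w` on the sphere corresponding to `t`. -/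
noncomputable def sliceEnergy (α : ℝ) (A : ℝ → ℝ) (w : EuclideanSpace ℝ (Fin N) → ℝ) (t : ℝ) : ℝ :=
  t ^ kk N α * (∫ θ : Sph N, polSliceDeriv (1 + α / 2) w t θ ^ 2 ∂sphMeas N +
    1 / ((1 + α / 2) * t) ^ 2 * sphDir (polSlice (1 + α / 2) w t) (polSlice (1 + α / 2) w t) -
    A t * ∫ θ : Sph N, polSlice (1 + α / 2) w t θ ^ 2 ∂sphMeas N)

theorem integrable_pot_polSlice [NeZero N] (hα : 0 < α) (hA : ContinuousOn A (Ioi 0))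
    (hb : ∃ C, ∀ t > 0, |A t| ≤ C) (hw : Dmem N α w) :
    Integrable (fun z : ℝ × Sph N => A z.1 * (z.1 ^ kk N α *
      polSlice (1 + α / 2) w z.1 z.2 ^ 2)) (polMeas N) := by
  obtain ⟨C, hC⟩ := hb
  refine (integrable_polMeas_pieces hα hw).1.bdd_mul (c := C) ?_ ?_
  · exact (hA.aestronglyMeasurable measurableSet_Ioi).comp_quasiMeasurePreserving
      Measure.quasiMeasurePreserving_fst
  · filter_upwards [ae_polMeas] with z hz using hC _ hz

theorem sliceEnergy_integral [NeZero N] (hα : 0 < α) (hA : ContinuousOn A (Ioi 0))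
    (hb : ∃ C, ∀ t > 0, |A t| ≤ C) (hw : Dmem N α w) :
    IntegrableOn (sliceEnergy α A w) (Ioi 0) ∧
    Qform N α (fun x => A (2 / (2 + α) * ‖x‖ ^ ((2 + α) / 2))) w =
      (1 + α / 2) ^ kk N α * ∫ t in Ioi (0 : ℝ), sliceEnergy α A w t := by
  have hβ : 0 < 1 + α / 2 := by positivity
  obtain ⟨-, h2, h3⟩ := integrable_polMeas_pieces hα hw
  have h1 := integrable_pot_polSlice hα hA hb hw
  have hi := (h2.add h3).sub h1
  have e : ∀ t ∈ Ioi (0 : ℝ), ∫ θ : Sph N, (t ^ kk N α * polSliceDeriv (1 + α / 2) w t θ ^ 2 +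
      t ^ kk N α * (1 / ((1 + α / 2) * t) ^ 2 * polAng (1 + α / 2) w (t, θ)) -
      A t * (t ^ kk N α * polSlice (1 + α / 2) w t θ ^ 2)) ∂sphMeas N = sliceEnergy α A w t := by
    intro t ht
    have i1 := (integrable_sphMeas ((continuous_polSlice_sph hβ hw.1 ht).pow 2)).const_mul
      (t ^ kk N α) |>.const_mul (A t)
    have i2 := (integrable_sphMeas ((continuous_polSliceDeriv_sph hβ hw.1 ht).pow 2)).const_mul
      (t ^ kk N α)
    have i3 : Integrable (fun θ : Sph N => t ^ kk N α * (1 / ((1 + α / 2) * t) ^ 2 *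
        polAng (1 + α / 2) w (t, θ))) (sphMeas N) := by
      refine (Integrable.const_mul (integrable_sphMeas ?_) _).const_mul _
      refine continuous_const.mul (continuous_finsetSum _ fun a _ =>
        continuous_finsetSum _ fun b _ =>
        Continuous.pow ?_ 2)
      exact (continuousOn_angDeriv hw.1 a b).comp_continuous
        (by simp only [polMap]; fun_prop)
        fun θ => smul_ne_zero (polRad_pos hβ ht).ne' θ.ne_zero
    simp only [Pi.pow_apply] at i1 i2
    have i23 := i2.add i3
    simp only [Pi.add_def] at i23
    rw [integral_sub i23 i1, integral_add i2 i3]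
    simp only [integral_const_mul]
    rw [sliceEnergy, sphDir_polSlice hβ hw.1 ht]
    ring
  refine ⟨IntegrableOn.congr_fun hi.integral_prod_left e measurableSet_Ioi, ?_⟩
  rw [qform_polar hα hw.1 hA]
  congr 1
  rw [← setIntegral_congr_fun measurableSet_Ioi e]
  refine Eq.trans (integral_congr_ae (Eventually.of_forall fun z => ?_)) (integral_prod _ hi)
  simp only [Pi.sub_apply, Pi.add_apply, polDt, polSliceDeriv, polSlice, polMap]
  ring

theorem integrableOn_pot_sphRem [NeZero N] (hα : 0 < α) (hA : ContinuousOn A (Ioi 0))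
    (hb : ∃ C, ∀ t > 0, |A t| ≤ C) (hw : Dmem N α w) (hY : IsSphBasis M Y μ) :
    IntegrableOn (fun t => t ^ kk N α * (A t * sphRem Y (polSlice (1 + α / 2) w t))) (Ioi 0) := by
  have h1 := (integrable_pot_polSlice hα hA hb hw).integral_prod_left
  have h2 := integrable_finsetSum Finset.univ fun i _ => memE.integrableOn_pot_mul hA hb
    (memE_sphCoef_polSlice hα hw hY i) (memE_sphCoef_polSlice hα hw hY i)
  refine (h1.sub h2).congr (Eventually.of_forall fun t => ?_)
  simp only [Pi.sub_apply, integral_const_mul, sphRem, ← Finset.mul_sum, sq]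
  ring

theorem neg_integral_sphRem_le [NeZero N] (hN : 3 ≤ N) (hα : 0 < α)
    (h : IsDiffSol (kk N α) A W)
    (hm : MorseIndexOne (kk N α) A) (hw : Dmem N α w) (hM₀ : 1 + α / 2 ≤ M₀ + 2)
    (hY₀ : IsSphBasis M₀ Y₀ μ₀)
    (horth : ∀ i, hardyForm (kk N α) W
      (fun t => sphCoef (polSlice (1 + α / 2) w t) (Y₀ i)) = 0)
    (hY : IsSphBasis M Y μ) :
    -∫ t in Ioi (0 : ℝ), t ^ kk N α * (A t * sphRem Y (polSlice (1 + α / 2) w t)) ≤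
      ∫ t in Ioi (0 : ℝ), sliceEnergy α A w t := by
  have hβ : 0 < 1 + α / 2 := by positivity
  set ψ : ι → ℝ → ℝ := fun i t => sphCoef (polSlice (1 + α / 2) w t) (Y i) with hψ
  have hE : ∀ i, memE (kk N α) (ψ i) := fun i => memE_sphCoef_polSlice hα hw hY i
  have i1 : ∀ i, IntegrableOn (fun t => t ^ kk N α *
      (deriv (ψ i) t * deriv (ψ i) t - A t * (ψ i t * ψ i t)) +
      μ i / (1 + α / 2) ^ 2 * (t ^ (kk N α - 2) * (ψ i t * ψ i t))) (Ioi 0) := fun i =>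
    (memE.integrableOn_radForm h.cont h.bdd (hE i) (hE i)).add
      (((hE i).integrableOn_hardy_mul h.one_lt (hE i)).const_mul _)
  have i2 := integrableOn_pot_sphRem hα h.cont h.bdd hw hY
  have hsum : 0 ≤ ∑ i, ∫ t in Ioi (0 : ℝ), (t ^ kk N α *
      (deriv (ψ i) t * deriv (ψ i) t - A t * (ψ i t * ψ i t)) +
      μ i / (1 + α / 2) ^ 2 * (t ^ (kk N α - 2) * (ψ i t * ψ i t))) := by
    refine Finset.sum_nonneg fun i _ => ?_
    rw [integral_add (memE.integrableOn_radForm h.cont h.bdd (hE i) (hE i))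
      (((hE i).integrableOn_hardy_mul h.one_lt (hE i)).const_mul _), integral_const_mul]
    exact radForm_sphCoef_nonneg hN hα h hm hw hM₀ hY₀ horth hY i
  rw [← integral_finsetSum _ fun i _ => i1 i] at hsum
  have hS := integrable_finsetSum Finset.univ fun i _ => i1 i
  have hle : ∫ t in Ioi (0 : ℝ), ((∑ i, (t ^ kk N α *
      (deriv (ψ i) t * deriv (ψ i) t - A t * (ψ i t * ψ i t)) +
      μ i / (1 + α / 2) ^ 2 * (t ^ (kk N α - 2) * (ψ i t * ψ i t)))) -
      t ^ kk N α * (A t * sphRem Y (polSlice (1 + α / 2) w t))) ≤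
      ∫ t in Ioi (0 : ℝ), sliceEnergy α A w t := by
    refine setIntegral_mono_on (hS.sub i2) (sliceEnergy_integral hα h.cont h.bdd hw).1
      measurableSet_Ioi fun t ht => ?_
    have ht0 : 0 < t := ht
    have hp := Real.rpow_pos_of_pos ht0 (kk N α)
    have b1 := hY.sphRem_nonneg (continuous_polSliceDeriv_sph hβ hw.1 ht0)
    have b2 := hY.sum_le_sphDir (contDiffOn_polSlice hβ hw.1 ht0)
    have b3 := mul_le_mul_of_nonneg_left b2 (by positivity : 0 ≤ 1 / ((1 + α / 2) * t) ^ 2)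
    have e2 : t ^ (kk N α - 2) = t ^ kk N α / t ^ 2 := by
      rw [show kk N α - 2 = kk N α - (2 : ℕ) by push_cast; ring, Real.rpow_sub_natCast ht0.ne']
    have key : (∑ i, (t ^ kk N α * (deriv (ψ i) t * deriv (ψ i) t - A t * (ψ i t * ψ i t)) +
        μ i / (1 + α / 2) ^ 2 * (t ^ (kk N α - 2) * (ψ i t * ψ i t)))) =
        t ^ kk N α * (∑ i, sphCoef (polSliceDeriv (1 + α / 2) w t) (Y i) ^ 2 +
          1 / ((1 + α / 2) * t) ^ 2 * ∑ i, μ i * sphCoef (polSlice (1 + α / 2) w t) (Y i) ^ 2 -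
          A t * ∑ i, sphCoef (polSlice (1 + α / 2) w t) (Y i) ^ 2) := by
      rw [Finset.mul_sum, Finset.mul_sum, ← Finset.sum_add_distrib, ← Finset.sum_sub_distrib,
        Finset.mul_sum]
      refine Finset.sum_congr rfl fun i _ => ?_
      rw [e2, hψ, deriv_sphCoef_polSlice hβ hw.1 _ ht0]
      field_simp
      ring
    rw [key, ← mul_sub, sliceEnergy]
    refine mul_le_mul_of_nonneg_left ?_ hp.le
    rw [sphRem] at b1 ⊢
    linarith
  rw [integral_sub hS i2] at hle
  linarith

theorem qform_nonneg [NeZero N] (hN : 3 ≤ N) (hα : 0 < α) (h : IsDiffSol (kk N α) A W)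
    (hm : MorseIndexOne (kk N α) A) (hw : Dmem N α w) (hM₀ : 1 + α / 2 ≤ M₀ + 2)
    (hY₀ : IsSphBasis M₀ Y₀ μ₀)
    (horth : ∀ i, hardyForm (kk N α) W
      (fun t => sphCoef (polSlice (1 + α / 2) w t) (Y₀ i)) = 0) :
    0 ≤ Qform N α (fun x => A (2 / (2 + α) * ‖x‖ ^ ((2 + α) / 2))) w := by
  have hβ : 0 < 1 + α / 2 := by positivity
  rw [(sliceEnergy_integral hα h.cont h.bdd hw).2]
  refine mul_nonneg (by positivity) ?_
  choose Z ν hZ using fun M => exists_isSphBasis (N := N) (by omega) M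
  obtain ⟨C, hC⟩ := h.bdd
  have hlim : Tendsto (fun M => -∫ t in Ioi (0 : ℝ), t ^ kk N α *
      (A t * sphRem (Z M) (polSlice (1 + α / 2) w t)))
      atTop (𝓝 (-∫ _ in Ioi (0 : ℝ), (0 : ℝ))) := by
    refine (tendsto_integral_of_dominated_convergence (fun t => C * ∫ θ : Sph N,
      t ^ kk N α * polSlice (1 + α / 2) w t θ ^ 2 ∂sphMeas N) (fun M =>
      (integrableOn_pot_sphRem hα h.cont h.bdd hw (hZ M)).aestronglyMeasurable)
      ((integrable_polMeas_pieces hα hw).1.integral_prod_left.const_mul C) (fun M => ?_) ?_).neg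
    · refine (ae_restrict_iff' measurableSet_Ioi).2 (Eventually.of_forall fun t ht => ?_)
      have hp := Real.rpow_nonneg (le_of_lt (mem_Ioi.1 ht)) (kk N α)
      have h1 := (hZ M).sphRem_nonneg (continuous_polSlice_sph hβ hw.1 ht)
      rw [norm_mul, norm_mul, Real.norm_of_nonneg hp, Real.norm_of_nonneg h1, integral_const_mul,
        mul_left_comm]
      exact mul_le_mul (hC t ht) (mul_le_mul_of_nonneg_left (sphRem_le_integral _ _) hp)
        (mul_nonneg hp h1) ((abs_nonneg _).trans (hC t ht))
    · refine (ae_restrict_iff' measurableSet_Ioi).2 (Eventually.of_forall fun t ht => ?_)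
      have := (tendsto_sphRem hZ (continuous_polSlice_sph hβ hw.1 ht)).const_mul (A t)
        |>.const_mul (t ^ kk N α)
      simpa only [mul_zero] using this
  rw [integral_zero, neg_zero] at hlim
  exact le_of_tendsto hlim (Eventually.of_forall fun M =>
    neg_integral_sphRem_le hN hα h hm hw hM₀ hY₀ horth (hZ M))

end Decomposition

section Separated

variable {N : ℕ} {α : ℝ} {A W : ℝ → ℝ}

theorem angDeriv_congr_sph {f g : EuclideanSpace ℝ (Fin N) → ℝ} {θ : Sph N}
    (hf : DifferentiableAt ℝ f θ) (hg : DifferentiableAt ℝ g θ) (h : ∀ η : Sph N, f η = g η)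
    (a b : Fin N) : angDeriv a b f θ = angDeriv a b g θ := by
  obtain ⟨R, hR0, hR⟩ := exists_rotation a b
  have key : ∀ f : EuclideanSpace ℝ (Fin N) → ℝ, DifferentiableAt ℝ f θ →
      HasDerivAt (fun s => f (R s θ)) (angDeriv a b f θ) 0 := fun f hf => by
    have h1 := hR 0 θ
    rw [hR0] at h1
    exact HasFDerivAt.comp_hasDerivAt_of_eq 0 hf.hasFDerivAt h1 (hR0 _).symm
  refine (key f hf).unique ?_
  exact (key g hg).congr_of_eventuallyEq (Eventually.of_forall fun s => h ⟨R s θ, by simp⟩)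

/-- The function with radial profile `W` (in the variable `t`) and angular profile `p`. -/
noncomputable def sepFun (α : ℝ) (W : ℝ → ℝ) (p : MvPolynomial (Fin N) ℝ)
    (x : EuclideanSpace ℝ (Fin N)) : ℝ :=
  W (2 / (2 + α) * ‖x‖ ^ ((2 + α) / 2)) * polyFun p (‖x‖⁻¹ • x)

theorem contDiffOn_sepFun (hα : 0 < α) (hW : ContDiffOn ℝ 1 W (Ioi 0))
    (p : MvPolynomial (Fin N) ℝ) : ContDiffOn ℝ 1 (sepFun α W p) {x | x ≠ 0} := by
  have hn : ContDiffOn ℝ 1 (fun x : EuclideanSpace ℝ (Fin N) => ‖x‖) {x | x ≠ 0} :=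
    fun x hx => (contDiffAt_norm ℝ hx).contDiffWithinAt
  refine ContDiffOn.mul (hW.comp (contDiffOn_const.mul
    (hn.rpow_const_of_ne fun x hx => norm_ne_zero_iff.2 hx)) fun x hx => ?_)
    ((contDiff_polyFun p).comp_contDiffOn ((hn.inv fun x hx => norm_ne_zero_iff.2 hx).smul
      contDiffOn_id))
  have : 0 < ‖x‖ := norm_pos_iff.2 hx
  exact mem_Ioi.2 (by positivity)

theorem polSlice_sepFun (hα : 0 < α) (W : ℝ → ℝ) (p : MvPolynomial (Fin N) ℝ) {t : ℝ} (ht : 0 < t)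
    (θ : Sph N) : polSlice (1 + α / 2) (sepFun α W p) t θ = W t * polyFun p θ := by
  have hβ : 0 < 1 + α / 2 := by positivity
  have h := arg_polMap (z := (t, θ)) hα ht
  have hn := norm_polMap (z := (t, θ)) hβ ht
  simp only [polMap] at h hn
  rw [polSlice, sepFun, h, hn, inv_smul_smul₀ (polRad_pos hβ ht).ne']

theorem polSliceDeriv_sepFun (hα : 0 < α) (hW : ContDiffOn ℝ 1 W (Ioi 0))
    (p : MvPolynomial (Fin N) ℝ) {t : ℝ} (ht : 0 < t) (θ : Sph N) :
    polSliceDeriv (1 + α / 2) (sepFun α W p) t θ = deriv W t * polyFun p θ := by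
  refine (hasDerivAt_polSlice (by positivity) (contDiffOn_sepFun hα hW p) ht θ.ne_zero).unique ?_
  refine ((((hW.differentiableOn one_ne_zero).differentiableAt
    (Ioi_mem_nhds ht)).hasDerivAt).mul_const (polyFun p θ)).congr_of_eventuallyEq ?_
  filter_upwards [Ioi_mem_nhds ht] with s hs using polSlice_sepFun hα W p hs θ

theorem angDeriv_polSlice_sepFun (hα : 0 < α) (hW : ContDiffOn ℝ 1 W (Ioi 0))
    (p : MvPolynomial (Fin N) ℝ) {t : ℝ} (ht : 0 < t) (a b : Fin N) (θ : Sph N) :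
    angDeriv a b (polSlice (1 + α / 2) (sepFun α W p) t) θ =
      W t * angDeriv a b (polyFun p) θ := by
  have hβ : 0 < 1 + α / 2 := by positivity
  have hp : DifferentiableAt ℝ (polyFun p) (θ : EuclideanSpace ℝ (Fin N)) :=
    (contDiffOn_polyFun p).differentiableAt_ne_zero θ.ne_zero
  rw [angDeriv_congr_sph (g := fun x => W t * polyFun p x)
    ((contDiffOn_polSlice hβ (contDiffOn_sepFun hα hW p) ht).differentiableAt_ne_zero θ.ne_zero)
    (hp.const_mul _) (polSlice_sepFun hα W p ht), angDeriv, fderiv_const_mul hp]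
  rfl

theorem polAng_sepFun (hα : 0 < α) (hW : ContDiffOn ℝ 1 W (Ioi 0))
    (p : MvPolynomial (Fin N) ℝ) {t : ℝ} (ht : 0 < t) (θ : Sph N) :
    polAng (1 + α / 2) (sepFun α W p) (t, θ) =
      W t ^ 2 * (1 / 2 * ∑ a, ∑ b, polyFun (angPoly a b p) θ ^ 2) := by
  have hβ : 0 < 1 + α / 2 := by positivity
  have e : ∀ a b, angDeriv a b (sepFun α W p) (polMap (1 + α / 2) (t, θ)) =
      W t * polyFun (angPoly a b p) θ := fun a b => by
    rw [← angDeriv_polyFun, ← angDeriv_polSlice_sepFun hα hW p ht]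
    exact (angDeriv_comp_smul (contDiffOn_sepFun hα hW p) (polRad_pos hβ ht).ne' a b
      θ.ne_zero).symm
  simp only [polAng, e, mul_pow, ← Finset.mul_sum]
  ring

theorem dmem_sepFun [NeZero N] (hα : 0 < α) (hk : 1 < kk N α) (hW : memE (kk N α) W)
    (p : MvPolynomial (Fin N) ℝ) : Dmem N α (sepFun α W p) := by
  refine (dmem_iff_polar hα (contDiffOn_sepFun hα hW.1 p)).2 ⟨?_, ?_⟩
  · refine (hW.integrableOn_sq.mul_prod
      (integrable_sphMeas ((continuous_polyFun_sph p).pow 2))).congr ?_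
    filter_upwards [ae_polMeas] with z hz
    have := polSlice_sepFun hα W p hz z.2
    rw [polSlice] at this
    rw [polMap, this, Pi.pow_apply]
    ring
  · have hc : Continuous fun θ : Sph N => 1 / 2 * ∑ a, ∑ b, polyFun (angPoly a b p) θ ^ 2 :=
      continuous_const.mul (continuous_finsetSum _ fun a _ => continuous_finsetSum _ fun b _ =>
        (continuous_polyFun_sph _).pow 2)
    refine ((hW.integrableOn_deriv_sq.mul_prod
      (integrable_sphMeas ((continuous_polyFun_sph p).pow 2))).add
      (((hW.integrableOn_hardy_mul hk hW).const_mul (1 / (1 + α / 2) ^ 2)).mul_prod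
        (integrable_sphMeas hc))).congr ?_
    filter_upwards [ae_polMeas] with z hz
    have h1 := polSliceDeriv_sepFun hα hW.1 p hz z.2
    rw [polSliceDeriv] at h1
    have e2 : z.1 ^ (kk N α - 2) = z.1 ^ kk N α / z.1 ^ 2 := by
      rw [show kk N α - 2 = kk N α - (2 : ℕ) by push_cast; ring, Real.rpow_sub_natCast hz.ne']
    rw [polDt, polMap, h1, polAng_sepFun hα hW.1 p hz]
    simp only [Pi.add_apply, Pi.pow_apply, e2]
    field_simp

theorem qform_sepFun [NeZero N] (hα : 0 < α) (h : IsDiffSol (kk N α) A W)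
    (p : MvPolynomial (Fin N) ℝ) :
    Qform N α (fun x => A (2 / (2 + α) * ‖x‖ ^ ((2 + α) / 2))) (sepFun α W p) =
      (1 + α / 2) ^ kk N α * hardyForm (kk N α) W W *
        (sphDir (polyFun p) (polyFun p) / (1 + α / 2) ^ 2 -
          kk N α * ∫ θ : Sph N, polyFun p θ ^ 2 ∂sphMeas N) := by
  rw [(sliceEnergy_integral hα h.cont h.bdd (dmem_sepFun hα h.one_lt h.mem p)).2]
  set P := ∫ θ : Sph N, polyFun p θ ^ 2 ∂sphMeas N with hP
  set D := sphDir (polyFun p) (polyFun p) with hD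
  have e : ∀ t ∈ Ioi (0 : ℝ), sliceEnergy α A (sepFun α W p) t =
      P * (t ^ kk N α * (deriv W t * deriv W t - A t * (W t * W t))) +
        D / (1 + α / 2) ^ 2 * (t ^ (kk N α - 2) * (W t * W t)) := fun t ht => by
    have ht0 : 0 < t := ht
    have e2 : t ^ (kk N α - 2) = t ^ kk N α / t ^ 2 := by
      rw [show kk N α - 2 = kk N α - (2 : ℕ) by push_cast; ring, Real.rpow_sub_natCast ht0.ne']
    have eD : sphDir (polSlice (1 + α / 2) (sepFun α W p) t)
        (polSlice (1 + α / 2) (sepFun α W p) t) = W t ^ 2 * D := by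
      have : ∀ (a b : Fin N) (θ : Sph N), W t * angDeriv a b (polyFun p) θ *
          (W t * angDeriv a b (polyFun p) θ) =
          W t ^ 2 * (angDeriv a b (polyFun p) θ * angDeriv a b (polyFun p) θ) :=
        fun a b θ => by ring
      simp only [hD, sphDir, angDeriv_polSlice_sepFun hα h.mem.1 p ht0, this, integral_const_mul,
        ← Finset.mul_sum]
      ring
    simp only [sliceEnergy, polSlice_sepFun hα W p ht0, polSliceDeriv_sepFun hα h.mem.1 p ht0,
      mul_pow, integral_const_mul, ← hP, eD, e2]
    field_simp
    ring
  rw [setIntegral_congr_fun measurableSet_Ioi e, integral_add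
    ((memE.integrableOn_radForm h.cont h.bdd h.mem h.mem).const_mul _)
    ((h.mem.integrableOn_hardy_mul h.one_lt h.mem).const_mul _), integral_const_mul,
    integral_const_mul]
  have hR := h.radForm_eq h.mem
  rw [radForm] at hR
  rw [hR, hardyForm]
  ring

theorem qform_sum_sepFun_neg [NeZero N] {ι : Type*} [Fintype ι] [DecidableEq ι] {M : ℕ}
    {Y : ι → MvPolynomial (Fin N) ℝ} {μ : ι → ℝ} (hN : 3 ≤ N) (hα : 0 < α)
    (h : IsDiffSol (kk N α) A W) (hY : IsSphBasis M Y μ) (hM : (M : ℝ) + 1 < 1 + α / 2)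
    {c : ι → ℝ} (hc : c ≠ 0) :
    Qform N α (fun x => A (2 / (2 + α) * ‖x‖ ^ ((2 + α) / 2)))
      (fun x => ∑ i, c i * sepFun α W (Y i) x) < 0 := by
  have e : (fun x => ∑ i, c i * sepFun α W (Y i) x) = sepFun α W (∑ i, c i • Y i) := by
    funext x
    rw [sepFun, polyFun_sum_smul, Finset.mul_sum]
    exact Finset.sum_congr rfl fun i _ => mul_left_comm _ _ _
  rw [e, qform_sepFun hα h, hY.sphDir_sum]
  simp only [polyFun_sum_smul]
  rw [hY.integral_sum_sq, Finset.sum_div, Finset.mul_sum, ← Finset.sum_sub_distrib]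
  have hμ : ∀ i, μ i / (1 + α / 2) ^ 2 < kk N α := fun i => by
    obtain ⟨j, -, hj, -, hμ, -⟩ := hY.degree i
    rw [hμ]
    refine sphEig_div_lt_kk hN hα (lt_of_le_of_lt ?_ hM)
    exact_mod_cast hj
  obtain ⟨i₀, hi₀⟩ := Function.ne_iff.1 hc
  refine mul_neg_of_pos_of_neg (mul_pos (by positivity) h.hardyForm_pos) ?_
  have e2 : ∀ i, μ i * c i ^ 2 / (1 + α / 2) ^ 2 - kk N α * c i ^ 2 =
      (μ i / (1 + α / 2) ^ 2 - kk N α) * c i ^ 2 := fun i => by ring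
  simp only [e2]
  exact Finset.sum_neg' (fun i _ => mul_nonpos_of_nonpos_of_nonneg (by linarith [hμ i])
    (sq_nonneg _)) ⟨i₀, Finset.mem_univ _, mul_neg_of_neg_of_pos (by linarith [hμ i₀])
    (sq_pos_of_ne_zero hi₀)⟩

end Separated

section Combinations

variable {N : ℕ} {α : ℝ} {A W : ℝ → ℝ}

theorem Dmem.const_mul {w : EuclideanSpace ℝ (Fin N) → ℝ} (hw : Dmem N α w) (c : ℝ) :
    Dmem N α (fun x => c * w x) := by
  refine ⟨contDiffOn_const.mul hw.1, (hw.2.1.const_mul (c ^ 2)).congr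
    (Eventually.of_forall fun x => by ring), (hw.2.2.const_mul (c ^ 2)).congr
    (Eventually.of_forall fun x => ?_)⟩
  have : fderiv ℝ (fun x => c * w x) x = c • fderiv ℝ w x :=
    congrFun (fderiv_const_smul_field (f := w) c) x
  simp only [this, norm_smul, mul_pow, Real.norm_eq_abs, sq_abs]

theorem Dmem.add [NeZero N] {v w : EuclideanSpace ℝ (Fin N) → ℝ} (hv : Dmem N α v)
    (hw : Dmem N α w) : Dmem N α (v + w) := by
  have hc := hv.1.add hw.1
  have hsq : ∀ a b : ℝ, (a + b) ^ 2 ≤ 2 * a ^ 2 + 2 * b ^ 2 := fun a b => by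
    nlinarith [sq_nonneg (a - b)]
  refine ⟨hc, ((hv.2.1.const_mul 2).add (hw.2.1.const_mul 2)).mono'
    (aestronglyMeasurable_of_continuousOn ?_) ?_, ((hv.2.2.const_mul 2).add
    (hw.2.2.const_mul 2)).mono' (aestronglyMeasurable_of_continuousOn
      ((hc.continuousOn_fderiv_of_isOpen isOpen_ne le_rfl).norm.pow 2)) ?_⟩
  · exact (continuous_norm.continuousOn.rpow_const fun x hx =>
      Or.inl (norm_ne_zero_iff.2 hx)).mul (hc.continuousOn.pow 2)
  · refine Eventually.of_forall fun x => ?_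
    have hp := Real.rpow_nonneg (norm_nonneg x) α
    rw [Real.norm_of_nonneg (mul_nonneg hp (sq_nonneg _)), Pi.add_apply, Pi.add_apply]
    nlinarith [mul_le_mul_of_nonneg_left (hsq (v x) (w x)) hp]
  · filter_upwards [ae_ne_zero] with x hx
    rw [Real.norm_of_nonneg (sq_nonneg _), fderiv_add (hv.1.differentiableAt_ne_zero hx)
      (hw.1.differentiableAt_ne_zero hx), Pi.add_apply]
    exact (pow_le_pow_left₀ (norm_nonneg _) (norm_add_le _ _) 2).trans (hsq _ _)

theorem dmem_sum [NeZero N] {ι : Type*} (s : Finset ι) {b : ι → EuclideanSpace ℝ (Fin N) → ℝ}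
    (hb : ∀ j, Dmem N α (b j)) (c : ι → ℝ) : Dmem N α (fun x => ∑ j ∈ s, c j * b j x) := by
  have e : (fun x => ∑ j ∈ s, c j * b j x) = ∑ j ∈ s, fun x => c j * b j x := by
    funext x
    simp
  rw [e]
  refine Finset.sum_induction _ (Dmem N α) (fun _ _ => Dmem.add) ?_
    fun j _ => (hb j).const_mul (c j)
  refine ⟨contDiffOn_const, ?_, ?_⟩ <;> simp

theorem sphCoef_polSlice_sum {β : ℝ} (hβ : 0 < β) {ι : Type*} [Fintype ι]
    {b : ι → EuclideanSpace ℝ (Fin N) → ℝ} (hb : ∀ j, ContDiffOn ℝ 1 (b j) {x | x ≠ 0})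
    (c : ι → ℝ) (p : MvPolynomial (Fin N) ℝ) {t : ℝ} (ht : 0 < t) :
    sphCoef (polSlice β (fun x => ∑ j, c j * b j x) t) p =
      ∑ j, c j * sphCoef (polSlice β (b j) t) p := by
  have hi : ∀ j, Integrable (fun θ : Sph N => c j * (polSlice β (b j) t θ * polyFun p θ))
      (sphMeas N) := fun j =>
    (integrable_sphMeas ((continuous_polSlice_sph hβ (hb j) ht).mul
      (continuous_polyFun_sph p))).const_mul _
  simp only [sphCoef, ← integral_const_mul]
  rw [← integral_finsetSum _ fun j _ => hi j]
  refine integral_congr_ae (Eventually.of_forall fun θ => ?_)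
  simp only [polSlice, Finset.sum_mul, mul_assoc]

theorem exists_qform_nonneg [NeZero N] {ι κ : Type*} [Fintype ι] [DecidableEq ι] [Fintype κ]
    {M : ℕ} {Y : ι → MvPolynomial (Fin N) ℝ} {μ : ι → ℝ} (hN : 3 ≤ N) (hα : 0 < α)
    (h : IsDiffSol (kk N α) A W) (hm : MorseIndexOne (kk N α) A) (hM : 1 + α / 2 ≤ M + 2)
    (hY : IsSphBasis M Y μ) (hcard : Fintype.card ι < Fintype.card κ)
    {b : κ → EuclideanSpace ℝ (Fin N) → ℝ} (hb : ∀ j, Dmem N α (b j)) :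
    ∃ c : κ → ℝ, c ≠ 0 ∧ 0 ≤ Qform N α (fun x => A (2 / (2 + α) * ‖x‖ ^ ((2 + α) / 2)))
      (fun x => ∑ j, c j * b j x) := by
  have hβ : 0 < 1 + α / 2 := by positivity
  let G : Matrix ι κ ℝ := fun i j =>
    hardyForm (kk N α) W (fun t => sphCoef (polSlice (1 + α / 2) (b j) t) (Y i))
  obtain ⟨c, hc, hc0⟩ := Submodule.exists_mem_ne_zero_of_ne_bot
    (G.mulVecLin.ker_ne_bot_of_finrank_lt (by simpa using hcard))
  rw [LinearMap.mem_ker, Matrix.mulVecLin_apply] at hc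
  refine ⟨c, hc0, qform_nonneg hN hα h hm (dmem_sum _ hb c) hM hY fun i => ?_⟩
  have e : ∀ t ∈ Ioi (0 : ℝ), t ^ (kk N α - 2) * (W t *
      sphCoef (polSlice (1 + α / 2) (fun x => ∑ j, c j * b j x) t) (Y i)) =
      ∑ j, c j * (t ^ (kk N α - 2) *
        (W t * sphCoef (polSlice (1 + α / 2) (b j) t) (Y i))) := fun t ht => by
    rw [sphCoef_polSlice_sum hβ (fun j => (hb j).1) c _ ht, Finset.mul_sum, Finset.mul_sum]
    exact Finset.sum_congr rfl fun j _ => by ring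
  rw [hardyForm, setIntegral_congr_fun measurableSet_Ioi e, integral_finsetSum]
  · simp only [integral_const_mul]
    have := congrFun hc i
    rw [Matrix.mulVec, dotProduct, Pi.zero_apply] at this
    exact (Finset.sum_congr rfl fun j _ => mul_comm _ _).trans this
  · exact fun j _ => (h.mem.integrableOn_hardy_mul h.one_lt
      (memE_sphCoef_polSlice hα (hb j) hY i)).const_mul _

end Combinations

theorem stmt7 (N : ℕ) (hN : 3 ≤ N) (α : ℝ) (hα : 0 < α)
    (F : ℝ → ℝ) (hF : ContDiff ℝ 1 F)
    (V : ℝ → ℝ) (hV : ContDiffOn ℝ 2 V (Ioi 0)) (hVpos : ∀ t > (0:ℝ), 0 < V t)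
    (hode : ∀ t > (0:ℝ), -(deriv (deriv V) t) - kk N α / t * deriv V t = F (V t))
    (hV'0 : Tendsto (deriv V) (𝓝[>] 0) (𝓝 0)) (hVinf : Tendsto V atTop (𝓝 0))
    (hmorse : MorseIndexOne (kk N α) (fun t => deriv F (V t)))
    (hV'E : memE (kk N α) (deriv V)) :
    (∃ b : Fin (mval N α) → EuclideanSpace ℝ (Fin N) → ℝ,
      (∀ j, Dmem N α (b j)) ∧
      ∀ c : Fin (mval N α) → ℝ, c ≠ 0 →
        Qform N α (fun x => deriv F (V (2 / (2 + α) * ‖x‖ ^ ((2 + α) / 2))))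
          (fun x => ∑ j, c j * b j x) < 0) ∧
    ¬ ∃ b : Fin (mval N α + 1) → EuclideanSpace ℝ (Fin N) → ℝ,
      (∀ j, Dmem N α (b j)) ∧
      ∀ c : Fin (mval N α + 1) → ℝ, c ≠ 0 →
        Qform N α (fun x => deriv F (V (2 / (2 + α) * ‖x‖ ^ ((2 + α) / 2))))
          (fun x => ∑ j, c j * b j x) < 0 := by
  have : NeZero N := ⟨by omega⟩
  have hk := one_lt_kk hN hα
  have h := isDiffSol_deriv hk hF hV hVpos hode hV'0 hVinf hV'E
  obtain ⟨M, hM⟩ : ∃ M, ⌈1 + α / 2⌉₊ = M + 2 := by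
    have : 1 < ⌈1 + α / 2⌉₊ := Nat.lt_ceil.2 (by push_cast; linarith)
    exact ⟨⌈1 + α / 2⌉₊ - 2, by omega⟩
  have hM1 : (M : ℝ) + 1 < 1 + α / 2 := by
    have : M + 1 < ⌈1 + α / 2⌉₊ := by omega
    exact_mod_cast Nat.lt_ceil.1 this
  have hM2 : 1 + α / 2 ≤ M + 2 := by
    have := Nat.le_ceil (1 + α / 2)
    rw [hM] at this
    exact_mod_cast this
  obtain ⟨Y, μ, hY⟩ := exists_isSphBasis (N := N) (by omega) M
  rw [mval_eq_finrank N hN α M hM]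
  refine ⟨⟨fun j => sepFun α (deriv V) (Y j), fun j => dmem_sepFun hα hk hV'E _, fun c hc =>
    qform_sum_sepFun_neg hN hα h hY hM1 hc⟩, ?_⟩
  rintro ⟨b, hb, hneg⟩
  obtain ⟨c, hc, hnn⟩ := exists_qform_nonneg hN hα h hmorse hM2 hY (by simp) hb
  exact (hneg c hc).not_ge hnn
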